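/- arXiv:1010.3424 — 2 statements merged into one kernel-verified Lean document; each statement's English description precedes it below -/
import Mathlib

section
/- Let G and H be finitely generated sofic groups, Γ ≤ G a finitely generated amenable subgroup, and φ : Γ → H an injective homomorphism. Then the amalgamated free product G *_φ H (amalgamating Γ with φ(Γ)) is sofic. -/
open Filter Topology

/-- A finite colored (edge-labeled) directed graph with labels in `L`. -/
structure CGraph (L : Type) where
  n : ℕ
  edges : Finset (Fin n × Fin n × L)

namespace CGraph

variable {L : Type} [DecidableEq L]

/-- Map an edge along a vertex map. -/
def mapEdge {n m : ℕ} (f : Fin n → Fin m) (e : Fin n × Fin n × L) : Fin m × Fin m × L :=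
  (f e.1, f e.2.1, e.2.2)

/-- The vertices appearing in an edge set. -/
def supp {n : ℕ} (E : Finset (Fin n × Fin n × L)) : Finset (Fin n) :=
  E.image (·.1) ∪ E.image (·.2.1)

/-- `f`, `EA` witness an `r`-isomorphism between `A` and `B`: `EA` is a subgraph of `A`
containing at least a `(1 - 1/r)`-fraction of the edges of `A`, whose image under the
(injective-on-`EA`) vertex map `f` is a subgraph of `B` containing at least a
`(1 - 1/r)`-fraction of the edges of `B`. -/
def IsRIsoWitness (r : ℕ) (A B : CGraph L) (f : Fin A.n → Fin B.n)
    (EA : Finset (Fin A.n × Fin A.n × L)) : Prop :=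
  EA ⊆ A.edges ∧ Set.InjOn f (supp EA) ∧
    EA.image (mapEdge f) ⊆ B.edges ∧
    ((1 : ℝ) - 1 / r) * A.edges.card ≤ EA.card ∧
    ((1 : ℝ) - 1 / r) * B.edges.card ≤ EA.card

/-- `A` and `B` are `r`-isomorphic colored graphs. -/
def RIso (r : ℕ) (A B : CGraph L) : Prop :=
  ∃ f EA, IsRIsoWitness r A B f EA

/-- Disjoint union of colored graphs. -/
def disjUnion (A B : CGraph L) : CGraph L :=
  ⟨A.n + B.n,
    (A.edges.image (mapEdge (Fin.castAdd B.n))) ∪ (B.edges.image (mapEdge (Fin.natAdd A.n)))⟩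

/-- Disjoint union of `k` copies of `A`. -/
def nsmul : ℕ → CGraph L → CGraph L
  | 0, _ => ⟨0, ∅⟩
  | k + 1, A => disjUnion A (nsmul k A)

/-- The linear combination `α · T`: disjoint union of `α i` copies of `T i`. -/
def lincomb {m : ℕ} (α : Fin m → ℕ) (T : Fin m → CGraph L) : CGraph L :=
  (List.finRange m).foldr (fun i B => disjUnion (nsmul (α i) (T i)) B) ⟨0, ∅⟩

/-- Restriction of a colored graph to the edges whose color lies in `Z`. -/
def restrict (A : CGraph L) (Z : Finset L) : CGraph L :=
  ⟨A.n, A.edges.filter (fun e => e.2.2 ∈ Z)⟩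

variable {Γ : Type*} [Group Γ]

/-- The ball of radius `r` around `1` in the Cayley graph of `Γ` with respect to the
generators `lab '' S`. -/
def ball (lab : L → Γ) (S : Finset L) (r : ℕ) : Set Γ :=
  {γ | ∃ w : List L, (∀ x ∈ w, x ∈ S) ∧ w.length ≤ r ∧ (w.map lab).prod = γ}

/-- The vertex `p` of `G` has an `r`-neighborhood isomorphic, as a rooted edge-labeled
graph, to the `r`-ball of the Cayley graph of `Γ` with generators `lab '' S`. -/
def GoodVertex (lab : L → Γ) (S : Finset L) (G : CGraph L) (r : ℕ) (p : Fin G.n) : Prop :=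
  ∃ f : Γ → Fin G.n, f 1 = p ∧ Set.InjOn f (ball lab S r) ∧
    ∀ γ ∈ ball lab S r, ∀ δ ∈ ball lab S r, ∀ c : L,
      ((f γ, f δ, c) ∈ G.edges ↔ (c ∈ S ∧ δ = γ * lab c))

/-- `G` is an `r`-approximation of the Cayley graph of `Γ` with generators `lab '' S`. -/
def IsApprox (lab : L → Γ) (S : Finset L) (G : CGraph L) (r : ℕ) : Prop :=
  ((1 : ℝ) - 1 / r) * G.n < {p : Fin G.n | GoodVertex lab S G r p}.ncard

/-- A sofic approximation: for each `r`, eventually all graphs are `r`-approximations. -/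
def SoficApprox (lab : L → Γ) (S : Finset L) (G : ℕ → CGraph L) : Prop :=
  ∀ r : ℕ, ∀ᶠ n in atTop, IsApprox lab S (G n) r

/-- Two vertices are adjacent with respect to an edge set (ignoring colors/orientation). -/
def adjRel {n : ℕ} (E : Finset (Fin n × Fin n × L)) (a b : Fin n) : Prop :=
  ∃ c, (a, b, c) ∈ E ∨ (b, a, c) ∈ E

/-- The connected component of `v` with respect to an edge set. -/
def component {n : ℕ} (E : Finset (Fin n × Fin n × L)) (v : Fin n) : Set (Fin n) :=
  {w | Relation.ReflTransGen (adjRel E) v w}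

/-- A sequence of finite colored graphs is hyperfinite if for every `ε > 0` there is `K`
such that from each `G n` one can erase at most `ε |E(G n)|` edges so that all components
of the remaining graph have at most `K` vertices. -/
def Hyperfinite (G : ℕ → CGraph L) : Prop :=
  ∀ ε : ℝ, 0 < ε → ∃ K : ℕ, ∀ n, ∃ F ⊆ (G n).edges,
    (F.card : ℝ) ≤ ε * (G n).edges.card ∧
    ∀ v, (component ((G n).edges \ F) v).ncard ≤ K

end CGraph

/-- The normalized Hamming rank of a permutation of `Fin n`. -/
noncomputable def rk {n : ℕ} (g : Equiv.Perm (Fin n)) : ℝ :=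
  1 - (Finset.univ.filter fun x => g x = x).card / n

/-- `F` is a Følner sequence of finite subsets of `Γ` with respect to the generating set `S`. -/
def IsFolnerSeq {Γ : Type*} [Group Γ] [DecidableEq Γ] (S : Finset Γ) (F : ℕ → Finset Γ) : Prop :=
  (∀ n, (F n).Nonempty) ∧ ∀ s ∈ S,
    Tendsto (fun n => (((F n).image (· * s) \ F n).card : ℝ) / (F n).card) atTop (𝓝 0)

/-- A sofic representation of `Γ`: a map to the product of finite symmetric groups which is a
homomorphism into the metric ultraproduct `Σ = (∏ Sₙ)/H` and is faithful there
(`rk (φ γ) = 1` for `γ ≠ 1`). -/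
def IsSoficRep (ω : Ultrafilter ℕ) {Γ : Type*} [Group Γ] (N : ℕ → ℕ)
    (φ : Γ → ∀ n : ℕ, Equiv.Perm (Fin (N n))) : Prop :=
  (∀ γ δ : Γ, Tendsto (fun n => rk ((φ γ n * φ δ n)⁻¹ * φ (γ * δ) n)) ω (𝓝 0)) ∧
  (∀ γ : Γ, γ ≠ 1 → Tendsto (fun n => rk (φ γ n)) ω (𝓝 1))

/-- Two sofic representations are conjugate by an element `g` of the metric ultraproduct. -/
def ConjugateReps (ω : Ultrafilter ℕ) {Γ : Type*} [Group Γ] (N : ℕ → ℕ)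
    (φ ψ : Γ → ∀ n : ℕ, Equiv.Perm (Fin (N n))) : Prop :=
  ∃ g : ∀ n : ℕ, Equiv.Perm (Fin (N n)), ∀ γ,
    Tendsto (fun n => rk ((g n * ψ γ n * (g n)⁻¹)⁻¹ * φ γ n)) ω (𝓝 0)

/-- A group is sofic: every finite subset admits arbitrarily good almost-multiplicative,
almost-free approximations by permutations. -/
def IsSofic (G : Type*) [Group G] : Prop :=
  ∀ (F : Finset G) (ε : ℝ), 0 < ε → ∃ (n : ℕ) (f : G → Equiv.Perm (Fin n)), 0 < n ∧
    (∀ g ∈ F, ∀ h ∈ F, rk ((f g * f h)⁻¹ * f (g * h)) ≤ ε) ∧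
    (∀ g ∈ F, g ≠ 1 → 1 - ε ≤ rk (f g))

open Classical in
/-- A group is amenable: it satisfies the Følner condition. -/
def IsAmenable (G : Type*) [Group G] : Prop :=
  ∀ (F : Finset G) (ε : ℝ), 0 < ε → ∃ A : Finset G, A.Nonempty ∧
    ∀ g ∈ F, (((A.image (g * ·)) \ A).card : ℝ) ≤ ε * A.card

/-- The two-element family of groups `{G, H}` indexed by `Bool`. -/
def fam (G H : Type) : Bool → Type := fun b => match b with
  | true => G
  | false => H

instance famGroup (G H : Type) [Group G] [Group H] : ∀ b, Group (fam G H b)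
  | true => ‹Group G›
  | false => ‹Group H›

/-- The diagram of the amalgamated product `G *_Γ H`: the inclusion `Γ ≤ G` and the injection
`φ : Γ → H`. -/
def amalgHoms (G H : Type) [Group G] [Group H] (Γ : Subgroup G) (φ : ↥Γ →* H) :
    ∀ b : Bool, ↥Γ →* fam G H b
  | true => Γ.subtype
  | false => φ

/-- The amalgamated free product `G *_φ H` amalgamating `Γ ≤ G` with `φ(Γ) ≤ H`. -/
def AmalgamatedProduct (G H : Type) [Group G] [Group H] (Γ : Subgroup G) (φ : ↥Γ →* H) :
    Type :=
  Monoid.PushoutI (amalgHoms G H Γ φ)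

noncomputable instance (G H : Type) [Group G] [Group H] (Γ : Subgroup G) (φ : ↥Γ →* H) :
    Group (AmalgamatedProduct G H Γ φ) :=
  inferInstanceAs (Group (Monoid.PushoutI (amalgHoms G H Γ φ)))

open scoped Pointwise

namespace SoficAmalgam

/-- The normalized counting measure of a subset of a finite type. -/
noncomputable def density {W : Type*} (s : Set W) : ℝ := s.ncard / Nat.card W

theorem density_nonneg {W : Type*} (s : Set W) : 0 ≤ density s := by
  unfold density; positivity

theorem density_mono {W : Type*} [Finite W] {s t : Set W} (h : s ⊆ t) :
    density s ≤ density t := by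
  unfold density
  gcongr
  exact t.toFinite

theorem density_union_le {W : Type*} (s t : Set W) :
    density (s ∪ t) ≤ density s + density t := by
  unfold density
  rw [← add_div]
  gcongr
  exact_mod_cast Set.ncard_union_le s t

theorem density_empty {W : Type*} : density (∅ : Set W) = 0 := by
  simp [density]

theorem density_compl {W : Type*} [Finite W] [Nonempty W] (s : Set W) :
    density sᶜ = 1 - density s := by
  have h := Set.ncard_add_ncard_compl s
  have hW : (0 : ℝ) < Nat.card W := by exact_mod_cast Nat.card_pos
  unfold density
  rw [← h] at hW ⊢
  push_cast at hW ⊢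
  field_simp
  ring

theorem density_biUnion_le {W κ : Type*} (t : Finset κ) (s : κ → Set W) {ε : ℝ}
    (h : ∀ i ∈ t, density (s i) ≤ ε) : density (⋃ i ∈ t, s i) ≤ t.card * ε := by
  classical
  induction t using Finset.induction_on with
  | empty => simp [density_empty]
  | insert a t ha ih =>
    rw [Finset.set_biUnion_insert, Finset.card_insert_of_notMem ha]
    have h1 := density_union_le (s a) (⋃ i ∈ t, s i)
    have h2 := h a (Finset.mem_insert_self a t)
    have h3 := ih fun i hi => h i (Finset.mem_insert_of_mem hi)
    push_cast
    linarith

theorem density_preimage_equiv {W V : Type*} (e : W ≃ V) (s : Set V) :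
    density (e ⁻¹' s) = density s := by
  unfold density
  rw [← Nat.card_congr e, ← Set.ncard_image_of_injective _ e.injective,
    Set.image_preimage_eq _ e.surjective]

theorem density_preimage_fst {W V : Type*} [Finite V] [Nonempty V] (s : Set W) :
    density (Prod.fst ⁻¹' s : Set (W × V)) = density s := by
  have hV : (Nat.card V : ℝ) ≠ 0 := by exact_mod_cast Nat.card_pos.ne'
  have : (Prod.fst ⁻¹' s : Set (W × V)) = s ×ˢ Set.univ := by ext; simp
  unfold density
  rw [this, Set.ncard_prod, Set.ncard_univ, Nat.card_prod]
  push_cast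
  rw [mul_div_mul_right _ _ hV]

theorem density_preimage_snd {W V : Type*} [Finite W] [Nonempty W] (s : Set V) :
    density (Prod.snd ⁻¹' s : Set (W × V)) = density s := by
  rw [← density_preimage_fst (V := W) s, ← density_preimage_equiv (Equiv.prodComm W V)]
  rfl

/-- A subset of a finite product has small density if all its sections over points outside
a small set have small density. -/
theorem density_le_of_fiber {W V : Type*} [Finite W] [Finite V] (s : Set (W × V)) (t : Set W)
    {ε : ℝ} (hε : 0 ≤ ε) (h : ∀ w ∉ t, density {v | (w, v) ∈ s} ≤ ε) :
    density s ≤ density t + ε := by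
  classical
  have := Fintype.ofFinite W
  have := Fintype.ofFinite V
  rcases isEmpty_or_nonempty W with hW | hW
  · simpa [density] using hε
  rcases isEmpty_or_nonempty V with hV | hV
  · simpa [density] using add_nonneg (density_nonneg t) hε
  have hWp : (0 : ℝ) < Nat.card W := by exact_mod_cast Nat.card_pos
  have hVp : (0 : ℝ) < Nat.card V := by exact_mod_cast Nat.card_pos
  have hs : s.ncard = ∑ w, {v | (w, v) ∈ s}.ncard := by
    rw [Set.ncard_eq_toFinset_card', Finset.card_eq_sum_card_fiberwise
      (f := Prod.fst) (t := Finset.univ) (by simp)]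
    refine Finset.sum_congr rfl fun w _ => ?_
    rw [Set.ncard_eq_toFinset_card']
    refine (Finset.card_bij (fun v _ => (w, v)) ?_ ?_ ?_).symm
    · simp
    · simp
    · rintro ⟨a, b⟩ hab
      simp only [Finset.mem_filter, Set.mem_toFinset] at hab
      obtain ⟨h1, rfl⟩ := hab
      exact ⟨b, by simpa using h1, rfl⟩
  have ht : (t.ncard : ℝ) = ∑ w, if w ∈ t then (1 : ℝ) else 0 := by
    rw [Set.ncard_eq_toFinset_card', Finset.sum_boole]
    congr 2
    ext; simp
  have key : (s.ncard : ℝ) ≤ t.ncard * Nat.card V + ε * (Nat.card W * Nat.card V) := by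
    have h2 : ε * (Nat.card W * Nat.card V : ℝ) = ∑ _w : W, ε * Nat.card V := by
      simp [mul_left_comm]
    rw [hs, ht, h2, Finset.sum_mul, ← Finset.sum_add_distrib]
    push_cast
    refine Finset.sum_le_sum fun w _ => ?_
    by_cases hw : w ∈ t
    · have : ({v | (w, v) ∈ s}.ncard : ℝ) ≤ Nat.card V := by
        exact_mod_cast Set.ncard_le_card _
      have h3 : 0 ≤ ε * (Nat.card V : ℝ) := by positivity
      simp only [hw, if_true]
      linarith
    · have := h w hw
      rw [density, div_le_iff₀ hVp] at this
      simpa [hw] using this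
  unfold density
  rw [Nat.card_prod, Nat.cast_mul, div_add' _ _ _ hWp.ne',
    div_le_div_iff₀ (mul_pos hWp hVp) hWp]
  nlinarith [key]

/-- The filter of asymptotically full subsets of a family of finite types. -/
def almostAll {ι : Type*} (l : Filter ι) (W : ι → Type*) [∀ i, Finite (W i)] :
    Filter (Σ i, W i) where
  sets := {A | Tendsto (fun i => density {w : W i | (⟨i, w⟩ : Σ i, W i) ∉ A}) l (𝓝 0)}
  univ_sets := by simpa [density_empty] using tendsto_const_nhds
  sets_of_superset := fun {A B} hA hAB =>
    squeeze_zero (fun _ => density_nonneg _)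
      (fun i => density_mono fun _ hw hA' => hw (hAB hA')) hA
  inter_sets := fun {A B} hA hB => by
    refine squeeze_zero (fun _ => density_nonneg _) (fun i => ?_)
      (by simpa using Tendsto.add hA hB)
    refine (density_mono fun w hw => ?_).trans (density_union_le _ _)
    exact not_and_or.1 hw

theorem eventually_almostAll {ι : Type*} {l : Filter ι} {W : ι → Type*} [∀ i, Finite (W i)]
    {p : (Σ i, W i) → Prop} :
    (∀ᶠ q in almostAll l W, p q) ↔ Tendsto (fun i => density {w : W i | ¬ p ⟨i, w⟩}) l (𝓝 0) :=
  Iff.rfl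

theorem tendsto_fst_almostAll {ι : Type*} (l : Filter ι) (W : ι → Type*) [∀ i, Finite (W i)] :
    Tendsto Sigma.fst (almostAll l W) l := by
  intro s hs
  refine tendsto_const_nhds.congr' ?_
  filter_upwards [hs] with i hi
  simp [hi, density_empty]

theorem tendsto_map_almostAll {ι : Type*} (l : Filter ι) {W V : ι → Type*} [∀ i, Finite (W i)]
    [∀ i, Finite (V i)] (f : ∀ i, W i → V i)
    (hf : ∀ i (s : Set (V i)), density (f i ⁻¹' s) = density s) :
    Tendsto (fun q : Σ i, W i => (⟨q.1, f q.1 q.2⟩ : Σ i, V i)) (almostAll l W)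
      (almostAll l V) := by
  intro s hs
  refine hs.congr fun i => ?_
  exact (hf i _).symm

theorem tendsto_perm_almostAll {ι : Type*} (l : Filter ι) {W : ι → Type*} [∀ i, Finite (W i)]
    (f : ∀ i, Equiv.Perm (W i)) :
    Tendsto (fun q : Σ i, W i => (⟨q.1, f q.1 q.2⟩ : Σ i, W i)) (almostAll l W)
      (almostAll l W) :=
  tendsto_map_almostAll l (fun i => f i) fun i s => density_preimage_equiv (f i) s

theorem rk_eq_density {n : ℕ} (hn : 0 < n) (g : Equiv.Perm (Fin n)) :
    rk g = density {x | g x ≠ x} := by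
  have : Nonempty (Fin n) := ⟨⟨0, hn⟩⟩
  have h : {x | g x ≠ x} = {x | g x = x}ᶜ := rfl
  rw [h, density_compl, rk, density, Nat.card_fin, Set.ncard_eq_toFinset_card']
  congr 4
  ext; simp

theorem rk_inv_mul_eq_density {n : ℕ} (hn : 0 < n) (f g h : Equiv.Perm (Fin n)) :
    rk ((f * g)⁻¹ * h) = density {x | ¬ f (g x) = h x} := by
  rw [rk_eq_density hn]
  congr 1
  ext x
  simp only [Set.mem_ofPred_eq, Equiv.Perm.mul_apply, ne_eq, not_iff_not]
  rw [Equiv.Perm.inv_eq_iff_eq, Equiv.Perm.mul_apply, eq_comm]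

theorem isSofic_of_almostAll {K ι : Type*} [Group K] {l : Filter ι} [l.NeBot] {W : ι → Type*}
    [∀ i, Finite (W i)] [∀ i, Nonempty (W i)] (f : K → ∀ i, Equiv.Perm (W i))
    (hmul : ∀ a b, ∀ᶠ q in almostAll l W, f a q.1 (f b q.1 q.2) = f (a * b) q.1 q.2)
    (hfree : ∀ a, a ≠ 1 → ∀ᶠ q in almostAll l W, f a q.1 q.2 ≠ q.2) : IsSofic K := by
  intro F ε hε
  have h1 : ∀ᶠ i in l, ∀ a ∈ F, ∀ b ∈ F,
      density {w | ¬ f a i (f b i w) = f (a * b) i w} ≤ ε := by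
    simp only [Filter.eventually_all_finset]
    intro a _ b _
    exact (eventually_almostAll.1 (hmul a b)).eventually_le_const hε
  have h2 : ∀ᶠ i in l, ∀ a ∈ F, a ≠ 1 → density {w | ¬ f a i w ≠ w} ≤ ε := by
    simp only [Filter.eventually_all_finset, Filter.eventually_imp_distrib_left]
    intro a _ ha
    exact (eventually_almostAll.1 (hfree a ha)).eventually_le_const hε
  obtain ⟨i, hi1, hi2⟩ := (h1.and h2).exists
  have hn : 0 < Nat.card (W i) := Nat.card_pos
  let e : W i ≃ Fin (Nat.card (W i)) := Finite.equivFin (W i)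
  refine ⟨Nat.card (W i), fun a => e.permCongr (f a i), hn, fun a ha b hb => ?_,
    fun a ha ha1 => ?_⟩
  · rw [rk_inv_mul_eq_density hn, ← density_preimage_equiv e]
    simpa [Set.preimage] using hi1 a ha b hb
  · rw [rk_eq_density hn, ← density_preimage_equiv e]
    have := hi2 a ha ha1
    have h3 : {w | ¬ f a i w ≠ w} = {w | f a i w ≠ w}ᶜ := rfl
    rw [h3, density_compl] at this
    simp only [Set.preimage, Equiv.permCongr_apply, Set.mem_ofPred_eq, Equiv.symm_apply_apply,
      ne_eq, EmbeddingLike.apply_eq_iff_eq]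
    simp only [ne_eq] at this
    linarith

/-- At the point `x`, the map `σ` looks like a free action as far as elements of `B` can see. -/
structure GoodAt {G X : Type*} [Group G] (σ : G → Equiv.Perm X) (B : Set G) (x : X) : Prop where
  one : σ 1 x = x
  mul : ∀ g ∈ B, ∀ h ∈ B, σ g (σ h x) = σ (g * h) x
  inj : Set.InjOn (fun g => σ g x) B

theorem exists_goodAt {G : Type*} [Group G] (hG : IsSofic G) {B : Set G} (hB : B.Finite)
    {ε : ℝ} (hε : 0 < ε) : ∃ (n : ℕ) (σ : G → Equiv.Perm (Fin n)), 0 < n ∧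
      density {x | ¬ GoodAt σ B x} ≤ ε := by
  classical
  have hfin : ({1} ∪ B ∪ B⁻¹ ∪ B⁻¹ * B).Finite :=
    (((Set.finite_singleton 1).union hB).union hB.inv).union (hB.inv.mul hB)
  set F := hfin.toFinset with hF
  have hone : (1 : G) ∈ F := by simp [hF]
  have hBF : ∀ g ∈ B, g ∈ F := fun g hg => by simp [hF, hg]
  have hBinv : ∀ g ∈ B, g⁻¹ ∈ F := fun g hg => by simp [hF, hg]
  have hBmul : ∀ g ∈ B, ∀ h ∈ B, g⁻¹ * h ∈ F := fun g hg h hh => by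
    rw [hF, Set.Finite.mem_toFinset]
    exact Or.inr (Set.mul_mem_mul (Set.inv_mem_inv.2 hg) hh)
  have hcard : 0 < F.card := Finset.card_pos.2 ⟨1, hone⟩
  obtain ⟨n, σ, hn, hmul, hfree⟩ := hG F (ε / ((F ×ˢ F).card + F.card))
    (by positivity)
  have : Nonempty (Fin n) := ⟨⟨0, hn⟩⟩
  refine ⟨n, σ, hn, ?_⟩
  have hsub : {x | ¬ GoodAt σ B x} ⊆
      (⋃ p ∈ F ×ˢ F, {x | ¬ σ p.1 (σ p.2 x) = σ (p.1 * p.2) x}) ∪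
      ⋃ g ∈ F, {x | g ≠ 1 ∧ σ g x = x} := by
    intro x hx
    by_contra h
    simp only [Set.mem_union, Set.mem_iUnion, not_or, not_exists, Finset.mem_product,
      Set.mem_ofPred_eq, not_not, Prod.forall, not_and] at h
    obtain ⟨h1, h2⟩ := h
    have hx1 : σ 1 x = x := by
      have := h1 1 1 ⟨hone, hone⟩
      rw [mul_one] at this
      exact (σ 1).injective this
    refine hx ⟨hx1, fun g hg k hk => h1 g k ⟨hBF g hg, hBF k hk⟩, fun g hg k hk hgk => ?_⟩
    by_contra hne
    refine h2 (g⁻¹ * k) (hBmul g hg k hk) (fun h3 => hne (inv_mul_eq_one.1 h3)) ?_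
    rw [← h1 _ _ ⟨hBinv g hg, hBF k hk⟩, ← show σ g x = σ k x from hgk,
      h1 _ _ ⟨hBinv g hg, hBF g hg⟩, inv_mul_cancel, hx1]
  refine (density_mono hsub).trans ((density_union_le _ _).trans ?_)
  have e1 := density_biUnion_le (F ×ˢ F)
    (fun p : G × G => {x | ¬ σ p.1 (σ p.2 x) = σ (p.1 * p.2) x})
    (ε := ε / ((F ×ˢ F).card + F.card)) (by
      intro p hp
      rw [Finset.mem_product] at hp
      rw [← rk_inv_mul_eq_density hn]
      exact hmul _ hp.1 _ hp.2)
  have e2 := density_biUnion_le F (fun g => {x | g ≠ 1 ∧ σ g x = x})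
    (ε := ε / ((F ×ˢ F).card + F.card)) (by
      intro g hg
      by_cases h : g = 1
      · simp only [h, ne_eq, not_true, false_and, Set.ofPred_false, density_empty]
        positivity
      · have := hfree g hg h
        rw [rk_eq_density hn] at this
        have h4 : {x | g ≠ 1 ∧ σ g x = x} = {x | σ g x ≠ x}ᶜ := by ext; simp [h]
        rw [h4, density_compl]
        linarith)
  refine (add_le_add e1 e2).trans ?_
  rw [← add_mul]
  apply le_of_eq
  field_simp

theorem exists_perm_extending {I V : Type*} [Finite V] {p q : I → V}
    (hp : Function.Injective p) (hq : Function.Injective q) :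
    ∃ s : Equiv.Perm V, ∀ i, s (p i) = q i := by
  classical
  have := Fintype.ofFinite V
  let e : {x // x ∈ Set.range p} ≃ {x // x ∈ Set.range q} :=
    (Equiv.ofInjective p hp).symm.trans (Equiv.ofInjective q hq)
  refine ⟨e.extendSubtype, fun i => ?_⟩
  rw [e.extendSubtype_apply_of_mem _ ⟨i, rfl⟩]
  simp only [e, Equiv.trans_apply]
  rw [show (⟨p i, ⟨i, rfl⟩⟩ : {x // x ∈ Set.range p}) = Equiv.ofInjective p hp i from rfl,
    Equiv.symm_apply_apply]
  rfl

/-- In a uniformly random ordering, a given element of `S` is minimal in `S` with probability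
at most `1 / |S|`. -/
theorem density_isMin_le {V : Type*} [Finite V] {N : ℕ} (S : Finset V) {v : V} (hv : v ∈ S) :
    density {ω : V ≃ Fin N | ∀ s ∈ S, ω v ≤ ω s} ≤ 1 / S.card := by
  classical
  have hΩ := Fintype.ofFinite (V ≃ Fin N)
  let E : V → Finset (V ≃ Fin N) := fun v => Finset.univ.filter fun ω => ∀ s ∈ S, ω v ≤ ω s
  have hE : ∀ v, {ω : V ≃ Fin N | ∀ s ∈ S, ω v ≤ ω s}.ncard = (E v).card := fun v => by
    rw [Set.ncard_eq_toFinset_card']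
    congr 1
    ext; simp [E]
  have hsymm : ∀ w ∈ S, (E w).card = (E v).card := by
    intro w hw
    have hSw : ∀ s ∈ S, Equiv.swap v w s ∈ S := by
      intro s hs
      by_cases h1 : s = v
      · rw [h1, Equiv.swap_apply_left]; exact hw
      · by_cases h2 : s = w
        · rw [h2, Equiv.swap_apply_right]; exact hv
        · rwa [Equiv.swap_apply_of_ne_of_ne h1 h2]
    refine Finset.card_bij' (fun ω _ => (Equiv.swap v w).trans ω)
      (fun ω _ => (Equiv.swap v w).trans ω) ?_ ?_ ?_ ?_
    · intro ω hω
      simp only [E, Finset.mem_filter, Finset.mem_univ, true_and] at hω ⊢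
      intro s hs
      simpa using hω _ (hSw s hs)
    · intro ω hω
      simp only [E, Finset.mem_filter, Finset.mem_univ, true_and] at hω ⊢
      intro s hs
      simpa using hω _ (hSw s hs)
    · intro ω _; ext; simp
    · intro ω _; ext; simp
  have hdisj : ∀ a ∈ S, ∀ b ∈ S, a ≠ b → Disjoint (E a) (E b) := by
    intro a ha b hb hab
    rw [Finset.disjoint_left]
    intro ω h1 h2
    simp only [E, Finset.mem_filter, Finset.mem_univ, true_and] at h1 h2
    exact hab (ω.injective (le_antisymm (h1 b hb) (h2 a ha)))
  have hsum : S.card * (E v).card ≤ Nat.card (V ≃ Fin N) := by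
    have h := Finset.card_biUnion hdisj
    rw [Finset.sum_congr rfl hsymm, Finset.sum_const, smul_eq_mul] at h
    rw [← h, Nat.card_eq_fintype_card]
    exact Finset.card_le_univ _
  have hS : (0 : ℝ) < S.card := by exact_mod_cast Finset.card_pos.2 ⟨v, hv⟩
  rcases isEmpty_or_nonempty (V ≃ Fin N) with h0 | h0
  · simp [density]
  have hpos : (0 : ℝ) < Nat.card (V ≃ Fin N) := by exact_mod_cast Nat.card_pos
  rw [density, hE, div_le_div_iff₀ hpos hS, one_mul, mul_comm]
  exact_mod_cast hsum

/-- If `U₁` and `U₂` are almost equal, then a uniformly random ordering most likely has the same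
minimum on both, attained at a common element. -/
theorem density_no_common_min_le {Γ V : Type*} [DecidableEq Γ] [Finite V] {N : ℕ} (p : Γ → V)
    (U₁ U₂ : Finset Γ) (hp : Set.InjOn p U₁) (hU : U₁.Nonempty) (hcard : U₁.card = U₂.card)
    {ε : ℝ} (hε : ((U₂ \ U₁).card : ℝ) ≤ ε * U₁.card) :
    density {ω : V ≃ Fin N | ¬ ∃ u ∈ U₁ ∩ U₂,
      (∀ v ∈ U₁, ω (p u) ≤ ω (p v)) ∧ ∀ v ∈ U₂, ω (p u) ≤ ω (p v)} ≤ 2 * ε := by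
  classical
  set S := (U₁ ∪ U₂).image p with hS
  set R := (U₁ \ U₂) ∪ (U₂ \ U₁) with hR
  have hsub : {ω : V ≃ Fin N | ¬ ∃ u ∈ U₁ ∩ U₂,
      (∀ v ∈ U₁, ω (p u) ≤ ω (p v)) ∧ ∀ v ∈ U₂, ω (p u) ≤ ω (p v)} ⊆
      ⋃ u ∈ R, {ω : V ≃ Fin N | ∀ s ∈ S, ω (p u) ≤ ω s} := by
    intro ω hω
    obtain ⟨u, hu, hmin⟩ := Finset.exists_min_image (U₁ ∪ U₂) (fun u => ω (p u))
      (hU.mono Finset.subset_union_left)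
    simp only [Set.mem_iUnion]
    refine ⟨u, ?_, ?_⟩
    · by_contra hur
      refine hω ⟨u, ?_, fun v hv => hmin v (Finset.mem_union_left _ hv),
        fun v hv => hmin v (Finset.mem_union_right _ hv)⟩
      simp only [hR, Finset.mem_union, Finset.mem_sdiff, Finset.mem_inter] at hu hur ⊢
      tauto
    · intro s hs
      obtain ⟨v, hv, rfl⟩ := Finset.mem_image.1 hs
      exact hmin v hv
  have hSc : U₁.card ≤ S.card := by
    rw [← Finset.card_image_of_injOn hp]
    exact Finset.card_le_card (Finset.image_subset_image Finset.subset_union_left)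
  have hU' : (0 : ℝ) < U₁.card := by exact_mod_cast Finset.card_pos.2 hU
  have hSc' : (U₁.card : ℝ) ≤ S.card := by exact_mod_cast hSc
  have hRc : (R.card : ℝ) ≤ 2 * (ε * U₁.card) := by
    have h1 : (R.card : ℝ) ≤ (U₁ \ U₂).card + (U₂ \ U₁).card := by
      exact_mod_cast Finset.card_union_le _ _
    rw [Finset.card_sdiff_comm hcard] at h1
    linarith
  refine (density_mono hsub).trans ((density_biUnion_le R _ fun u hu =>
    density_isMin_le S (v := p u) ?_).trans ?_)
  · refine Finset.mem_image_of_mem p ?_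
    simp only [hR, Finset.mem_union, Finset.mem_sdiff] at hu ⊢
    tauto
  · rw [mul_one_div, div_le_iff₀ (hU'.trans_le hSc')]
    have : 0 ≤ ε := by
      by_contra h
      push Not at h
      have := mul_neg_of_neg_of_pos h hU'
      have h3 : (0 : ℝ) ≤ (U₂ \ U₁).card := by positivity
      linarith
    nlinarith

/-- Prepend `t` to a list, or remove it if the list already starts with `t`. -/
def toggle {T : Type*} [DecidableEq T] (t : T) : List T → List T
  | [] => [t]
  | a :: l => if a = t then l else t :: a :: l

theorem isChain_toggle {T : Type*} [DecidableEq T] (t : T) {l : List T} (hl : l.IsChain (· ≠ ·)) :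
    (toggle t l).IsChain (· ≠ ·) := by
  cases l with
  | nil => simp [toggle]
  | cons a l =>
    by_cases h : a = t
    · simpa [toggle, h] using hl.tail
    · simpa [toggle, h, List.isChain_cons_cons, hl] using fun h' => h h'.symm

theorem toggle_toggle {T : Type*} [DecidableEq T] (t : T) {l : List T} (hl : l.IsChain (· ≠ ·)) :
    toggle t (toggle t l) = l := by
  cases l with
  | nil => simp [toggle]
  | cons a l =>
    by_cases h : a = t
    · subst h
      cases l with
      | nil => simp [toggle]
      | cons b l =>
        have : b ≠ a := (List.isChain_cons_cons.1 hl).1.symm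
        simp [toggle, this]
    · simp [toggle, h]

theorem toggle_of_isChain_cons {T : Type*} [DecidableEq T] {t : T} {l : List T}
    (hl : (t :: l).IsChain (· ≠ ·)) : toggle t l = t :: l := by
  cases l with
  | nil => rfl
  | cons a l =>
    have : a ≠ t := (List.isChain_cons_cons.1 hl).1.symm
    simp [toggle, this]

/-- A finite quotient of a free product of groups of order two in which short reduced words
survive. -/
theorem exists_involutions (T : Type) [Finite T] (N : ℕ) :
    ∃ (P : Type) (_ : Group P) (_ : Finite P) (u : T → P), (∀ t, u t * u t = 1) ∧
      ∀ l : List T, l.IsChain (· ≠ ·) → l ≠ [] → l.length ≤ N → (l.map u).prod ≠ 1 := by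
  classical
  let Q := {l : List T // l.IsChain (· ≠ ·) ∧ l.length ≤ N}
  have hQ : Finite Q := ((List.finite_length_le T N).subset (fun l hl => hl.2)).to_subtype
  let f : T → Q → Q := fun t q =>
    if h : (toggle t q.1).length ≤ N then ⟨toggle t q.1, isChain_toggle t q.2.1, h⟩ else q
  have hf : ∀ t, Function.Involutive (f t) := by
    intro t q
    by_cases h : (toggle t q.1).length ≤ N
    · have h2 : f t q = ⟨toggle t q.1, isChain_toggle t q.2.1, h⟩ := dif_pos h
      rw [h2]
      have h3 : (toggle t (toggle t q.1)).length ≤ N := by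
        rw [toggle_toggle t q.2.1]; exact q.2.2
      refine (dif_pos h3).trans (Subtype.ext ?_)
      exact toggle_toggle t q.2.1
    · have h2 : f t q = q := dif_neg h
      rw [h2, h2]
  refine ⟨Equiv.Perm Q, inferInstance, inferInstance, fun t => (hf t).toPerm, fun t => ?_, ?_⟩
  · ext1 q
    exact hf t q
  · intro l hl hne hlen hprod
    have key : ∀ l : List T, l.IsChain (· ≠ ·) → ∀ hlen : l.length ≤ N,
        (((l.map fun t => (hf t).toPerm).prod ⟨[], by simp⟩ : Q)).1 = l := by
      intro l
      induction l with
      | nil => intros; rfl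
      | cons t l ih =>
        intro hl hlen
        have h1 := ih hl.tail ((Nat.le_succ _).trans hlen)
        rw [List.map_cons, List.prod_cons, Equiv.Perm.mul_apply]
        generalize (List.map (fun t => (hf t).toPerm) l).prod ⟨[], by simp⟩ = q at h1
        have h2 : toggle t q.1 = t :: l := by rw [h1, toggle_of_isChain_cons hl]
        have h3 : (toggle t q.1).length ≤ N := by rw [h2]; exact hlen
        exact (congrArg Subtype.val (dif_pos h3)).trans h2
    have := key l hl hlen
    rw [hprod] at this
    exact hne this.symm

/-- A point has at most one centre: a good point `c` with `x = a • c` for some `a ∈ A`, minimal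
among the candidates `b⁻¹ • x`, `b ∈ A`. -/
theorem center_unique {Γ G X : Type*} [Group Γ] [Group G] {α : Γ →* G}
    (hα : Function.Injective α) {σ : G → Equiv.Perm X} {A : Finset Γ} {C : Set G}
    (hone : 1 ∈ C) (hA : ∀ a ∈ A, α a ∈ C ∧ α a⁻¹ ∈ C) {N : ℕ} {ω : X → Fin N}
    (hω : Function.Injective ω) {c c' : X} {a a' : Γ} (hc : GoodAt σ (C * C) c)
    (hc' : GoodAt σ (C * C) c') (ha : a ∈ A) (ha' : a' ∈ A)
    (hmin : ∀ b ∈ A, ω c ≤ ω (σ (α (b⁻¹ * a)) c))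
    (hmin' : ∀ b ∈ A, ω c' ≤ ω (σ (α (b⁻¹ * a')) c'))
    (h : σ (α a) c = σ (α a') c') : c = c' ∧ a = a' := by
  have hCC : ∀ g ∈ C, g ∈ C * C := fun g hg => by simpa using Set.mul_mem_mul hg hone
  have key : ∀ {c c' : X} {a a' : Γ}, GoodAt σ (C * C) c → GoodAt σ (C * C) c' → a ∈ A →
      a' ∈ A → σ (α a) c = σ (α a') c' → σ (α (a'⁻¹ * a)) c = c' := by
    intro c c' a a' hc hc' ha ha' h
    rw [map_mul, ← hc.mul _ (hCC _ (hA a' ha').2) _ (hCC _ (hA a ha).1), h,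
      hc'.mul _ (hCC _ (hA a' ha').2) _ (hCC _ (hA a' ha').1), ← map_mul, inv_mul_cancel,
      map_one, hc'.one]
  have h1 := key hc hc' ha ha' h
  have h2 := key hc' hc ha' ha h.symm
  have hcc : c = c' := by
    refine hω (le_antisymm ?_ ?_)
    · simpa only [h1] using hmin a' ha'
    · simpa only [h2] using hmin' a ha
  subst hcc
  exact ⟨rfl, hα (hc.inj (hCC _ (hA a ha).1) (hCC _ (hA a' ha').1) h)⟩

/-- Two almost free almost actions of an amenable group become almost conjugate after passing to
their product with the set of orderings. The map `tile` records the pieces on which the conjugacy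
`Θ` was defined. -/
theorem exists_matching {Γ G H X Y : Type*} [Group Γ] [Group G] [Group H] [Finite X] [Finite Y]
    {α : Γ →* G} {β : Γ →* H} (hα : Function.Injective α) (hβ : Function.Injective β)
    (σ : G → Equiv.Perm X) (τ : H → Equiv.Perm Y) (A : Finset Γ) (C : Set G) (C' : Set H)
    (hone : 1 ∈ C) (hone' : 1 ∈ C')
    (hA : ∀ a ∈ A, α a ∈ C ∧ α a⁻¹ ∈ C) (hA' : ∀ a ∈ A, β a ∈ C' ∧ β a⁻¹ ∈ C') (N : ℕ) :
    ∃ (Θ : Equiv.Perm (X × Y × (X ⊕ Y ≃ Fin N)))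
      (tile : X × Y × (X ⊕ Y ≃ Fin N) → X × Y × (X ⊕ Y ≃ Fin N))
      (D : Set (X × Y × (X ⊕ Y ≃ Fin N))),
      (∀ x y ω, A.Nonempty → GoodAt σ (C * C) x →
        (∀ a ∈ A, GoodAt σ (C * C) (σ (α a⁻¹) x)) → GoodAt τ (C' * C') y → (x, y, ω) ∈ D) ∧
      (∀ g ∈ C, ∀ x y ω, (x, y, ω) ∈ D → (σ g x, y, ω) ∈ D →
        tile (σ g x, y, ω) = tile (x, y, ω) → g ∈ α.range) ∧
      (∀ h ∈ C', ∀ z z', z ∈ D → z' ∈ D →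
        Θ z' = ((Θ z).1, τ h (Θ z).2.1, (Θ z).2.2) → tile z' = tile z → h ∈ β.range) ∧
      (∀ x y ω γ, α γ ∈ C → β γ ∈ C' → GoodAt σ (C * C) x →
        (∀ a ∈ A, GoodAt σ (C * C) (σ (α a⁻¹) x)) → GoodAt τ (C' * C') y →
        (∃ b ∈ A, γ * b ∈ A ∧
          (∀ a ∈ A, ω (.inl (σ (α b⁻¹) x)) ≤ ω (.inl (σ (α a⁻¹) x))) ∧
          ∀ a ∈ A, ω (.inl (σ (α b⁻¹) x)) ≤ ω (.inl (σ (α (a⁻¹ * γ)) x))) →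
        Θ (σ (α γ) x, y, ω) =
          ((Θ (x, y, ω)).1, τ (β γ) (Θ (x, y, ω)).2.1, (Θ (x, y, ω)).2.2) ∧
        tile (σ (α γ) x, y, ω) = tile (x, y, ω)) := by
  classical
  have hCC : ∀ g ∈ C, g ∈ C * C := fun g hg => by simpa using Set.mul_mem_mul hg hone
  have hCC' : ∀ g ∈ C', g ∈ C' * C' := fun g hg => by simpa using Set.mul_mem_mul hg hone'
  have hAA : ∀ b ∈ A, ∀ a ∈ A, α (b⁻¹ * a) ∈ C * C := fun b hb a ha => by
    rw [map_mul]; exact Set.mul_mem_mul (hA b hb).2 (hA a ha).1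
  have hAA' : ∀ b ∈ A, ∀ a ∈ A, β (b⁻¹ * a) ∈ C' * C' := fun b hb a ha => by
    rw [map_mul]; exact Set.mul_mem_mul (hA' b hb).2 (hA' a ha).1
  have hs : ∀ c d, ∃ s : Equiv.Perm (X ⊕ Y), GoodAt σ (C * C) c → GoodAt τ (C' * C') d →
      ∀ b ∈ A, ∀ a ∈ A, s (.inr (τ (β (b⁻¹ * a)) d)) = .inl (σ (α (b⁻¹ * a)) c) := by
    intro c d
    by_cases hcd : GoodAt σ (C * C) c ∧ GoodAt τ (C' * C') d
    · obtain ⟨hc, hd⟩ := hcd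
      let U := {u : Γ // ∃ b ∈ A, ∃ a ∈ A, b⁻¹ * a = u}
      have hp : Function.Injective fun u : U => (.inr (τ (β u.1) d) : X ⊕ Y) := by
        rintro ⟨_, b, hb, a, ha, rfl⟩ ⟨_, b', hb', a', ha', rfl⟩ h
        exact Subtype.ext (hβ (hd.inj (hAA' b hb a ha) (hAA' b' hb' a' ha') (Sum.inr_injective h)))
      have hq : Function.Injective fun u : U => (.inl (σ (α u.1) c) : X ⊕ Y) := by
        rintro ⟨_, b, hb, a, ha, rfl⟩ ⟨_, b', hb', a', ha', rfl⟩ h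
        exact Subtype.ext (hα (hc.inj (hAA b hb a ha) (hAA b' hb' a' ha') (Sum.inl_injective h)))
      obtain ⟨s, hs⟩ := exists_perm_extending hp hq
      exact ⟨s, fun _ _ b hb a ha => hs ⟨b⁻¹ * a, b, hb, a, ha, rfl⟩⟩
    · exact ⟨1, fun h1 h2 => absurd ⟨h1, h2⟩ hcd⟩
  choose s hs using hs
  let I := {t : (X × Y × (X ⊕ Y ≃ Fin N)) × Γ // GoodAt σ (C * C) t.1.1 ∧
    GoodAt τ (C' * C') t.1.2.1 ∧ t.2 ∈ A ∧
    ∀ b ∈ A, t.1.2.2 (.inl t.1.1) ≤ t.1.2.2 (.inl (σ (α (b⁻¹ * t.2)) t.1.1))}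
  let p : I → X × Y × (X ⊕ Y ≃ Fin N) := fun t => (σ (α t.1.2) t.1.1.1, t.1.1.2.1, t.1.1.2.2)
  let q : I → X × Y × (X ⊕ Y ≃ Fin N) := fun t =>
    (t.1.1.1, τ (β t.1.2) t.1.1.2.1, (s t.1.1.1 t.1.1.2.1).trans t.1.1.2.2)
  have hp : Function.Injective p := by
    rintro ⟨⟨⟨c, d, ω⟩, a⟩, hc, hd, ha, hm⟩ ⟨⟨⟨c', d', ω'⟩, a'⟩, hc', hd', ha', hm'⟩ h
    simp only [p, Prod.mk.injEq] at h hc hd ha hm hc' hd' ha' hm'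
    obtain ⟨h1, rfl, rfl⟩ := h
    obtain ⟨rfl, rfl⟩ := center_unique hα hone hA (ω := fun x => ω (.inl x))
      (ω.injective.comp Sum.inl_injective) hc hc' ha ha' hm hm' h1
    rfl
  have hq : Function.Injective q := by
    have hmin : ∀ c d ω, ∀ a ∈ A, GoodAt σ (C * C) c → GoodAt τ (C' * C') d →
        (∀ b ∈ A, ω (.inl c) ≤ ω (.inl (σ (α (b⁻¹ * a)) c))) →
        ∀ b ∈ A, (s c d).trans ω (.inr d) ≤
          ((s c d).trans ω : X ⊕ Y ≃ Fin N) (.inr (τ (β (b⁻¹ * a)) d)) := by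
      intro c d ω a ha hc hd hm b hb
      have h1 := hs c d hc hd a ha a ha
      rw [inv_mul_cancel, map_one, map_one, hc.one, hd.one] at h1
      rw [Equiv.trans_apply, Equiv.trans_apply, h1, hs c d hc hd b hb a ha]
      exact hm b hb
    rintro ⟨⟨⟨c, d, ω⟩, a⟩, hc, hd, ha, hm⟩ ⟨⟨⟨c', d', ω'⟩, a'⟩, hc', hd', ha', hm'⟩ h
    simp only [q, Prod.mk.injEq] at h hc hd ha hm hc' hd' ha' hm'
    obtain ⟨rfl, h1, h2⟩ := h
    have m1 := hmin c d ω a ha hc hd hm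
    have m2 := hmin c d' ω' a' ha' hc' hd' hm'
    rw [← h2] at m2
    obtain ⟨rfl, rfl⟩ := center_unique hβ hone' hA'
      (ω := fun y => (s c d).trans ω (.inr y))
      (((s c d).trans ω).injective.comp Sum.inr_injective) hd hd' ha ha' m1 m2 h1
    have : ω = ω' := by
      ext1 v
      have := DFunLike.congr_fun h2 ((s c d).symm v)
      simpa using this
    subst this
    rfl
  obtain ⟨Θ, hΘ⟩ := exists_perm_extending hp hq
  let tile : X × Y × (X ⊕ Y ≃ Fin N) → X × Y × (X ⊕ Y ≃ Fin N) := fun z =>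
    if h : ∃ t, p t = z then h.choose.1.1 else z
  have htile : ∀ t, tile (p t) = t.1.1 := by
    intro t
    have h : ∃ t', p t' = p t := ⟨t, rfl⟩
    have h1 : tile (p t) = h.choose.1.1 := dif_pos h
    rw [h1, hp h.choose_spec]
  have hcenter : ∀ x, GoodAt σ (C * C) x → ∀ b ∈ A, σ (α b) (σ (α b⁻¹) x) = x := by
    intro x hx b hb
    rw [hx.mul _ (hCC _ (hA b hb).1) _ (hCC _ (hA b hb).2), ← map_mul, mul_inv_cancel, map_one,
      hx.one]
  have hback : ∀ x, GoodAt σ (C * C) x → ∀ b ∈ A, GoodAt σ (C * C) (σ (α b⁻¹) x) → ∀ a ∈ A,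
      σ (α (a⁻¹ * b)) (σ (α b⁻¹) x) = σ (α a⁻¹) x := by
    intro x hx b hb hgood a ha
    rw [map_mul, ← hgood.mul _ (hCC _ (hA a ha).2) _ (hCC _ (hA b hb).1), hcenter x hx b hb]
  refine ⟨Θ, tile, Set.range p, ?_, ?_, ?_, ?_⟩
  · intro x y ω hAne hx hxA hy
    obtain ⟨b, hb, hmin⟩ := A.exists_min_image (fun b => ω (.inl (σ (α b⁻¹) x))) hAne
    refine ⟨⟨⟨⟨σ (α b⁻¹) x, y, ω⟩, b⟩, hxA b hb, hy, hb, fun a ha => ?_⟩, ?_⟩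
    · simp only [hback x hx b hb (hxA b hb) a ha]
      exact hmin a ha
    · simp only [p, hcenter x hx b hb]
  · rintro g hg x y ω ⟨t, ht⟩ ⟨t', ht'⟩ h
    rw [← ht, ← ht', htile, htile] at h
    obtain ⟨⟨⟨c, d, ω₀⟩, a⟩, hc, hd, ha, hm⟩ := t
    obtain ⟨⟨⟨c', d', ω'⟩, a'⟩, hc', hd', ha', hm'⟩ := t'
    simp only [p, Prod.mk.injEq] at ht ht' h hc ha ha'
    obtain ⟨rfl, rfl, rfl⟩ := h
    have e : σ (α a') c' = σ (g * α a) c' := by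
      rw [ht'.1, ← ht.1, hc.mul _ (hCC _ hg) _ (hCC _ (hA a ha).1)]
    have := hc.inj (hCC _ (hA a' ha').1) (Set.mul_mem_mul hg (hA a ha).1) e
    exact ⟨a' * a⁻¹, by rw [map_mul, this, map_inv, mul_inv_cancel_right]⟩
  · rintro g hg _ _ ⟨t, rfl⟩ ⟨t', rfl⟩ hΘ' h
    rw [htile, htile] at h
    rw [hΘ, hΘ] at hΘ'
    obtain ⟨⟨⟨c, d, ω₀⟩, a⟩, hc, hd, ha, hm⟩ := t
    obtain ⟨⟨⟨c', d', ω'⟩, a'⟩, hc', hd', ha', hm'⟩ := t'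
    simp only [q, Prod.mk.injEq] at hΘ' h hd ha ha'
    obtain ⟨rfl, rfl, rfl⟩ := h
    have e : τ (β a') d' = τ (g * β a) d' := by
      rw [hΘ'.2.1, hd.mul _ (hCC' _ hg) _ (hCC' _ (hA' a ha).1)]
    have := hd.inj (hCC' _ (hA' a' ha').1) (Set.mul_mem_mul hg (hA' a ha).1) e
    exact ⟨a' * a⁻¹, by rw [map_mul, this, map_inv, mul_inv_cancel_right]⟩
  · rintro x y ω γ hγ hγ' hx hxA hy ⟨b, hb, hγb, hm1, hm2⟩
    have hc := hxA b hb
    let t : I := ⟨⟨⟨σ (α b⁻¹) x, y, ω⟩, b⟩, hc, hy, hb, fun a ha => by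
      simp only [hback x hx b hb hc a ha]
      exact hm1 a ha⟩
    let t' : I := ⟨⟨⟨σ (α b⁻¹) x, y, ω⟩, γ * b⟩, hc, hy, hγb, fun a ha => by
      have : σ (α (a⁻¹ * (γ * b))) (σ (α b⁻¹) x) = σ (α (a⁻¹ * γ)) x := by
        rw [← mul_assoc, map_mul, ← hc.mul _ _ _ (hCC _ (hA b hb).1), hcenter x hx b hb]
        rw [map_mul]
        exact Set.mul_mem_mul (hA a ha).2 hγ
      simp only [this]
      exact hm2 a ha⟩
    have ht : p t = (x, y, ω) := by simp only [p, t, hcenter x hx b hb]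
    have ht' : p t' = (σ (α γ) x, y, ω) := by
      simp only [p, t']
      rw [map_mul, ← hc.mul _ (hCC _ hγ) _ (hCC _ (hA b hb).1), hcenter x hx b hb]
    refine ⟨?_, ?_⟩
    · rw [← ht, ← ht', hΘ, hΘ]
      simp only [q, t, t', Prod.mk.injEq, true_and, and_true]
      rw [map_mul, ← hy.mul _ (hCC' _ hγ') _ (hCC' _ (hA' b hb).1)]
    · rw [← ht, ← ht', htile, htile]

/-- The sequences of permutations that fix almost every point. -/
def almostTrivial {ι : Type*} (l : Filter ι) (W : ι → Type*) [∀ i, Finite (W i)] :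
    Subgroup (∀ i, Equiv.Perm (W i)) where
  carrier := {s | ∀ᶠ q in almostAll l W, s q.1 q.2 = q.2}
  one_mem' := Set.mem_ofPred_eq ▸ Filter.Eventually.of_forall fun _ => rfl
  mul_mem' := fun {s t} hs ht => by
    rw [Set.mem_ofPred_eq] at hs ht ⊢
    filter_upwards [hs, ht] with q h1 h2
    rw [Pi.mul_apply, Equiv.Perm.mul_apply, h2, h1]
  inv_mem' := fun {s} hs => by
    rw [Set.mem_ofPred_eq] at hs ⊢
    filter_upwards [hs] with q h
    rw [Pi.inv_apply, Equiv.Perm.inv_eq_iff_eq, h]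

theorem mem_almostTrivial {ι : Type*} {l : Filter ι} {W : ι → Type*} [∀ i, Finite (W i)]
    {s : ∀ i, Equiv.Perm (W i)} :
    s ∈ almostTrivial l W ↔ ∀ᶠ q in almostAll l W, s q.1 q.2 = q.2 := Iff.rfl

instance {ι : Type*} (l : Filter ι) (W : ι → Type*) [∀ i, Finite (W i)] :
    (almostTrivial l W).Normal where
  conj_mem s hs g := by
    rw [mem_almostTrivial] at hs ⊢
    filter_upwards [(tendsto_perm_almostAll l fun i => (g i)⁻¹).eventually hs] with q h
    rw [Pi.mul_apply, Pi.mul_apply, Pi.inv_apply, Equiv.Perm.mul_apply, Equiv.Perm.mul_apply, h]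
    exact (g q.1).apply_symm_apply q.2

theorem mk_eq_mk_iff {ι : Type*} {l : Filter ι} {W : ι → Type*} [∀ i, Finite (W i)]
    {s t : ∀ i, Equiv.Perm (W i)} :
    (s : (∀ i, Equiv.Perm (W i)) ⧸ almostTrivial l W) = t ↔
      ∀ᶠ q in almostAll l W, s q.1 q.2 = t q.1 q.2 := by
  rw [QuotientGroup.eq, mem_almostTrivial]
  refine Filter.eventually_congr (Filter.Eventually.of_forall fun q => ?_)
  rw [Pi.mul_apply, Pi.inv_apply, Equiv.Perm.mul_apply, Equiv.Perm.inv_eq_iff_eq, eq_comm]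

/-- An almost multiplicative map into sequences of permutations, as a homomorphism. -/
def almostHom {K ι : Type*} [Group K] {l : Filter ι} {W : ι → Type*} [∀ i, Finite (W i)]
    (f : K → ∀ i, Equiv.Perm (W i))
    (hf : ∀ a b, ∀ᶠ q in almostAll l W, f a q.1 (f b q.1 q.2) = f (a * b) q.1 q.2) :
    K →* (∀ i, Equiv.Perm (W i)) ⧸ almostTrivial l W :=
  MonoidHom.mk' (fun a => (f a : (∀ i, Equiv.Perm (W i)) ⧸ almostTrivial l W)) fun a b => by
    rw [← QuotientGroup.mk_mul, mk_eq_mk_iff]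
    filter_upwards [hf a b] with q h
    rw [← h]
    rfl

theorem isSofic_of_hom {K ι : Type*} [Group K] {l : Filter ι} [l.NeBot] {W : ι → Type*}
    [∀ i, Finite (W i)] [∀ i, Nonempty (W i)]
    (π : K →* (∀ i, Equiv.Perm (W i)) ⧸ almostTrivial l W)
    (hfree : ∀ a, a ≠ 1 → ∃ s : ∀ i, Equiv.Perm (W i), π a = s ∧
      ∀ᶠ q in almostAll l W, s q.1 q.2 ≠ q.2) : IsSofic K := by
  choose f hf using fun a => QuotientGroup.mk_surjective (π a)
  refine isSofic_of_almostAll (l := l) f (fun a b => ?_) fun a ha => ?_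
  · have h := mk_eq_mk_iff.1 ((QuotientGroup.mk_mul _ (f a) (f b)).trans
      ((congrArg₂ (· * ·) (hf a) (hf b)).trans ((map_mul π a b).symm.trans (hf (a * b)).symm)))
    filter_upwards [h] with q hq
    exact hq
  · obtain ⟨s, hs, hs'⟩ := hfree a ha
    filter_upwards [mk_eq_mk_iff.1 ((hf a).trans hs), hs'] with q h1 h2
    rwa [h1]

/-- Twist a permutation of `Z` by the coboundary of `v : Z → P`, with `v z` an involution. -/
def twist {Z P : Type*} [Group P] (v : Z → P) (e : Equiv.Perm Z) : Equiv.Perm (Z × P) :=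
  Equiv.prodShear e fun z => Equiv.mulLeft (v (e z) * v z)

theorem twist_apply {Z P : Type*} [Group P] (v : Z → P) (e : Equiv.Perm Z) (w : Z × P) :
    twist v e w = (e w.1, v (e w.1) * v w.1 * w.2) := rfl

section Word

variable {G H : Type} [Group G] [Group H] {Γ : Subgroup G} {φ : Γ →* H}

/-- The sequence of permutations attached to a letter of either factor. -/
def letterPerm {ι : Type*} {W : ι → Type*} (f : G → ∀ i, Equiv.Perm (W i))
    (g : H → ∀ i, Equiv.Perm (W i)) : (Σ b, fam G H b) → ∀ i, Equiv.Perm (W i)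
  | ⟨true, x⟩ => f x
  | ⟨false, y⟩ => g y

/-- Almost every point is moved, in the twisting coordinate, by a reduced word of tiles. -/
theorem eventually_word {ι : Type*} {l : Filter ι} {Z P : ι → Type*} [∀ i, Finite (Z i)]
    [∀ i, Group (P i)] [∀ i, Finite (P i)]
    (σ : G → ∀ i, Equiv.Perm (Z i)) (ψ : H → ∀ i, Equiv.Perm (Z i)) {T : ι → Type*}
    (tile : ∀ i, Z i → T i) (u : ∀ i, T i → P i)
    (hG : ∀ g ∉ Γ, ∀ᶠ q in almostAll l Z, tile q.1 (σ g q.1 q.2) ≠ tile q.1 q.2)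
    (hH : ∀ h ∉ φ.range, ∀ᶠ q in almostAll l Z, tile q.1 (ψ h q.1 q.2) ≠ tile q.1 q.2)
    (L : List (Σ b, fam G H b)) (hchain : L.IsChain fun x y => x.1 ≠ y.1)
    (hL : ∀ x ∈ L, x.2 ∉ (amalgHoms G H Γ φ x.1).range) :
    ∀ᶠ q in almostAll l fun i => Z i × P i, ∃ ts : List (T q.1),
      ts.IsChain (· ≠ ·) ∧ ts.length = 2 * L.countP (fun x => !x.1) ∧
      (((L.map (letterPerm (fun g i => Equiv.prodCongr (σ g i) (Equiv.refl (P i)))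
        fun h i => twist (fun z => u i (tile i z)) (ψ h i))).prod) q.1 q.2).2 =
        (ts.map (u q.1)).prod * q.2.2 ∧
      ∀ x ∈ L.head?, ∀ z, z = (((L.map (letterPerm
        (fun g i => Equiv.prodCongr (σ g i) (Equiv.refl (P i)))
        fun h i => twist (fun z => u i (tile i z)) (ψ h i))).prod) q.1 q.2).1 →
        (x.1 = false → ts.head? = some (tile q.1 z)) ∧
        (x.1 = true → ∀ t ∈ ts.head?, tile q.1 z ≠ t) := by
  set op := letterPerm (fun g i => Equiv.prodCongr (σ g i) (Equiv.refl (P i)))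
    fun h i => twist (fun z => u i (tile i z)) (ψ h i) with hop
  induction L with
  | nil => exact Filter.Eventually.of_forall fun q => ⟨[], by simp⟩
  | cons x L ih =>
    have ih' := ih hchain.tail fun y hy => hL y (List.mem_cons_of_mem _ hy)
    have hZ : Tendsto (fun q : Σ i, Z i × P i => (⟨q.1, ((L.map op).prod q.1 q.2).1⟩ : Σ i, Z i))
        (almostAll l fun i => Z i × P i) (almostAll l Z) :=
      (tendsto_map_almostAll l (fun i (w : Z i × P i) => w.1)
        fun i s => density_preimage_fst s).comp
        (tendsto_perm_almostAll l fun i => (L.map op).prod i)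
    have hx := hL x List.mem_cons_self
    have hempty : ∀ (i : ι) (ts : List (T i)), L = [] →
        ts.length = 2 * L.countP (fun x => !x.1) → ts = [] := by
      rintro i ts rfl h
      simpa using h
    obtain ⟨b, g⟩ := x
    cases b with
    | true =>
      have hg : g ∉ Γ := fun h => hx ⟨⟨g, h⟩, rfl⟩
      filter_upwards [ih', hZ.eventually (hG g hg)] with q ⟨ts, h1, h2, h3, h4⟩ h5
      refine ⟨ts, h1, by simpa using h2, ?_, ?_⟩
      · rw [List.map_cons, List.prod_cons, Pi.mul_apply, Equiv.Perm.mul_apply, ← h3]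
        rfl
      · rintro x hx z rfl
        simp only [List.head?_cons, Option.mem_def, Option.some.injEq] at hx
        subst hx
        refine ⟨fun h => absurd h (by simp), fun _ t ht => ?_⟩
        cases L with
        | nil =>
          rw [hempty _ ts rfl h2] at ht
          simp at ht
        | cons y L =>
          have hy : y.1 = false := by
            simpa using ((List.isChain_cons_cons.1 hchain).1).symm
          have h6 := (h4 y rfl _ rfl).1 hy
          rw [h6, Option.mem_def, Option.some.injEq] at ht
          subst ht
          exact h5
    | false =>
      have hg : g ∉ φ.range := fun ⟨γ, h⟩ => hx ⟨γ, h⟩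
      filter_upwards [ih', hZ.eventually (hH g hg)] with q ⟨ts, h1, h2, h3, h4⟩ h5
      refine ⟨tile q.1 (ψ g q.1 ((L.map op).prod q.1 q.2).1) ::
        tile q.1 ((L.map op).prod q.1 q.2).1 :: ts, ?_, ?_, ?_, ?_⟩
      · refine List.isChain_cons_cons.2 ⟨h5, ?_⟩
        rw [List.isChain_cons]
        refine ⟨fun t ht => ?_, h1⟩
        cases L with
        | nil =>
          rw [hempty _ ts rfl h2] at ht
          simp at ht
        | cons y L =>
          have hy : y.1 = true := by
            simpa using ((List.isChain_cons_cons.1 hchain).1).symm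
          exact (h4 y rfl _ rfl).2 hy t ht
      · simp [h2]
        ring
      · rw [List.map_cons, List.prod_cons, Pi.mul_apply, Equiv.Perm.mul_apply, List.map_cons,
          List.map_cons, List.prod_cons, List.prod_cons, mul_assoc, mul_assoc, ← h3, ← mul_assoc]
        rfl
      · rintro x hx z rfl
        simp only [List.head?_cons, Option.mem_def, Option.some.injEq] at hx
        subst hx
        exact ⟨fun _ => rfl, fun h => absurd h (by simp)⟩

theorem exists_prod_eq_of (L : List (Σ b, fam G H b)) (hL : ∀ x ∈ L, x.1 = true) :
    ∃ g : G, (L.map fun x => Monoid.PushoutI.of (φ := amalgHoms G H Γ φ) x.1 x.2).prod =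
      Monoid.PushoutI.of (φ := amalgHoms G H Γ φ) true g := by
  induction L with
  | nil => exact ⟨1, (map_one (Monoid.PushoutI.of (φ := amalgHoms G H Γ φ) true)).symm⟩
  | cons x L ih =>
    obtain ⟨g, hg⟩ := ih fun y hy => hL y (List.mem_cons_of_mem _ hy)
    have hx := hL x List.mem_cons_self
    obtain ⟨b, x⟩ := x
    cases hx
    refine ⟨(show G from x) * g, ?_⟩
    rw [List.map_cons, List.prod_cons, hg]
    exact (map_mul (Monoid.PushoutI.of (φ := amalgHoms G H Γ φ) true) _ _).symm

theorem isSofic_pushout_of_matching (hφ : Function.Injective φ) {ι : Type*} {l : Filter ι}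
    [l.NeBot] {Z : ι → Type} [∀ i, Finite (Z i)] [∀ i, Nonempty (Z i)] {len : ι → ℕ}
    (hlen : Tendsto len l atTop)
    (σ : G → ∀ i, Equiv.Perm (Z i)) (ψ : H → ∀ i, Equiv.Perm (Z i)) (tile : ∀ i, Z i → Z i)
    (hσ : ∀ a b, ∀ᶠ q in almostAll l Z, σ a q.1 (σ b q.1 q.2) = σ (a * b) q.1 q.2)
    (hψ : ∀ a b, ∀ᶠ q in almostAll l Z, ψ a q.1 (ψ b q.1 q.2) = ψ (a * b) q.1 q.2)
    (hfree : ∀ g, g ≠ 1 → ∀ᶠ q in almostAll l Z, σ g q.1 q.2 ≠ q.2)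
    (hΓ : ∀ γ : Γ, ∀ᶠ q in almostAll l Z, ψ (φ γ) q.1 q.2 = σ γ q.1 q.2)
    (htile : ∀ γ : Γ, ∀ᶠ q in almostAll l Z, tile q.1 (σ γ q.1 q.2) = tile q.1 q.2)
    (hG : ∀ g ∉ Γ, ∀ᶠ q in almostAll l Z, tile q.1 (σ g q.1 q.2) ≠ tile q.1 q.2)
    (hH : ∀ h ∉ φ.range, ∀ᶠ q in almostAll l Z, tile q.1 (ψ h q.1 q.2) ≠ tile q.1 q.2) :
    IsSofic (Monoid.PushoutI (amalgHoms G H Γ φ)) := by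
  classical
  choose P hP hPfin u hu2 hu using fun i => exists_involutions (Z i) (len i)
  have hfst : Tendsto (fun q : Σ i, Z i × P i => (⟨q.1, q.2.1⟩ : Σ i, Z i))
      (almostAll l fun i => Z i × P i) (almostAll l Z) :=
    tendsto_map_almostAll l (fun i (w : Z i × P i) => w.1) fun i s => density_preimage_fst s
  let f : G → ∀ i, Equiv.Perm (Z i × P i) := fun g i =>
    Equiv.prodCongr (σ g i) (Equiv.refl (P i))
  let k : H → ∀ i, Equiv.Perm (Z i × P i) := fun h i =>
    twist (fun z => u i (tile i z)) (ψ h i)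
  have hf : ∀ a b, ∀ᶠ q in almostAll l fun i => Z i × P i,
      f a q.1 (f b q.1 q.2) = f (a * b) q.1 q.2 := by
    intro a b
    filter_upwards [hfst.eventually (hσ a b)] with q h
    exact Prod.ext h rfl
  have hk : ∀ a b, ∀ᶠ q in almostAll l fun i => Z i × P i,
      k a q.1 (k b q.1 q.2) = k (a * b) q.1 q.2 := by
    intro a b
    filter_upwards [hfst.eventually (hψ a b)] with q h
    simp only [k, twist_apply, ← h, Prod.mk.injEq, true_and]
    have := hu2 q.1 (tile q.1 (ψ b q.1 q.2.1))
    calc _ = u q.1 (tile q.1 (ψ a q.1 (ψ b q.1 q.2.1))) *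
        (u q.1 (tile q.1 (ψ b q.1 q.2.1)) * u q.1 (tile q.1 (ψ b q.1 q.2.1))) *
        u q.1 (tile q.1 q.2.1) * q.2.2 := by simp only [mul_assoc]
      _ = _ := by rw [this, mul_one]
  have hfk : ∀ γ : Γ, ∀ᶠ q in almostAll l fun i => Z i × P i,
      k (φ γ) q.1 q.2 = f γ q.1 q.2 := by
    intro γ
    filter_upwards [hfst.eventually (hΓ γ), hfst.eventually (htile γ)] with q h1 h2
    simp only [k, f, twist_apply, h1, h2, hu2, one_mul]
    rfl
  let πb : ∀ b, fam G H b →* (∀ i, Equiv.Perm (Z i × P i)) ⧸ almostTrivial l fun i => Z i × P i :=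
    fun b => match b with
      | true => almostHom f hf
      | false => almostHom k hk
  let π : Monoid.PushoutI (amalgHoms G H Γ φ) →*
      (∀ i, Equiv.Perm (Z i × P i)) ⧸ almostTrivial l fun i => Z i × P i :=
    Monoid.PushoutI.lift πb ((almostHom f hf).comp Γ.subtype) (by
      intro b
      cases b with
      | true => rfl
      | false =>
        ext γ
        exact mk_eq_mk_iff.2 (hfk γ))
  have hπ : ∀ (b : Bool) (x : fam G H b),
      π (Monoid.PushoutI.of b x) = (letterPerm f k ⟨b, x⟩ : ∀ i, Equiv.Perm (Z i × P i)) := by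
    intro b x
    refine (Monoid.PushoutI.lift_of ..).trans ?_
    cases b <;> rfl
  have hinj : ∀ b, Function.Injective (amalgHoms G H Γ φ b) := by
    intro b
    cases b with
    | true => exact Γ.subtype_injective
    | false => exact hφ
  obtain ⟨d⟩ := Monoid.PushoutI.NormalWord.transversal_nonempty _ hinj
  refine isSofic_of_hom π fun a ha => ?_
  let w : Monoid.PushoutI.NormalWord d := Monoid.PushoutI.NormalWord.equiv a
  have hw : w.prod = a := Monoid.PushoutI.NormalWord.equiv.symm_apply_apply a
  have hred : ∀ x ∈ w.toList, x.2 ∉ (amalgHoms G H Γ φ x.1).range := by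
    rintro ⟨b, x⟩ hx hmem
    exact w.ne_one _ hx ((d.compl b).existsUnique x |>.elim fun y _ huniq => by
      have h1 := huniq (⟨x, hmem⟩, ⟨1, d.one_mem b⟩) (by simp)
      have h2 := huniq (1, ⟨x, w.normalized b x hx⟩) (by simp)
      simpa using congrArg (fun p => (p.1 : fam G H b)) (h1.trans h2.symm))
  have ha' : a = Monoid.PushoutI.of true (w.head : G) *
      (w.toList.map fun x => Monoid.PushoutI.of x.1 x.2).prod := by
    rw [← hw, Monoid.PushoutI.NormalWord.prod, Monoid.CoprodI.Word.prod, map_list_prod,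
      List.map_map]
    congr 1
    exact (Monoid.PushoutI.of_apply_eq_base (amalgHoms G H Γ φ) true w.head).symm
  by_cases hfalse : 0 < w.toList.countP fun x => !x.1
  · refine ⟨f w.head * (w.toList.map (letterPerm f k)).prod, ?_, ?_⟩
    · refine (congrArg π ha').trans ((map_mul π _ _).trans ?_)
      refine (congrArg₂ (· * ·) (hπ true _) ?_).trans (QuotientGroup.mk_mul _ _ _).symm
      refine (map_list_prod π _).trans ?_
      rw [← QuotientGroup.mk'_apply, map_list_prod, List.map_map, List.map_map]
      exact congrArg List.prod (List.map_congr_left fun x _ => hπ x.1 x.2)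
    · filter_upwards [eventually_word σ ψ tile u hG hH w.toList w.chain_ne hred,
        (hlen.comp (tendsto_fst_almostAll l _)).eventually_ge_atTop
          (2 * w.toList.countP fun x => !x.1)] with q ⟨ts, h1, h2, h3, _⟩ h4 h5
      refine hu q.1 ts h1 ?_ ?_ ?_
      · rintro rfl
        simp only [List.length_nil] at h2
        omega
      · rw [h2]
        exact h4
      · have h6 := congrArg Prod.snd h5
        rw [Pi.mul_apply, Equiv.Perm.mul_apply] at h6
        exact mul_eq_right.1 (h3.symm.trans h6)
  · have htrue : ∀ x ∈ w.toList, x.1 = true := by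
      intro x hx
      by_contra h
      exact hfalse (List.countP_pos_iff.2 ⟨x, hx, by simpa using h⟩)
    obtain ⟨g', hg'⟩ := exists_prod_eq_of (φ := φ) w.toList htrue
    obtain ⟨g, hg⟩ : ∃ g : G, a = Monoid.PushoutI.of (φ := amalgHoms G H Γ φ) true g :=
      ⟨w.head * g', ha'.trans ((congrArg _ hg').trans (map_mul _ _ _).symm)⟩
    subst hg
    have hg1 : g ≠ 1 := by
      rintro rfl
      exact ha (map_one (Monoid.PushoutI.of (φ := amalgHoms G H Γ φ) (i := true)))
    refine ⟨f g, hπ true g, ?_⟩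
    filter_upwards [hfst.eventually (hfree g hg1)] with q h1 h2
    exact h1 (congrArg Prod.fst h2)

end Word

theorem exists_finite_set {Γ G : Type*} [Group Γ] [Group G] (α : Γ →* G) (S : Finset G)
    (A E : Finset Γ) : ∃ C : Set G, C.Finite ∧ 1 ∈ C ∧ (∀ g ∈ S, g ∈ C) ∧
      (∀ a ∈ A, α a ∈ C ∧ α a⁻¹ ∈ C) ∧ ∀ γ ∈ E, α γ ∈ C := by
  refine ⟨{1} ∪ ↑S ∪ α '' (↑A ∪ ↑E) ∪ (fun a => α a⁻¹) '' ↑A, ?_, ?_, ?_, ?_, ?_⟩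
  · exact (((Set.finite_singleton 1).union S.finite_toSet).union
      ((A.finite_toSet.union E.finite_toSet).image _)).union (A.finite_toSet.image _)
  · exact .inl (.inl (.inl rfl))
  · exact fun g hg => .inl (.inl (.inr hg))
  · exact fun a ha => ⟨.inl (.inr ⟨a, .inl ha, rfl⟩), .inr ⟨a, ha, rfl⟩⟩
  · exact fun γ hγ => .inl (.inr ⟨γ, .inr hγ, rfl⟩)

/-- Two finite subsets of sofic groups and a finite subset of a common amenable subgroup can be
made to act almost freely on one finite set, compatibly on the amenable subgroup and with tiles
that are almost invariant exactly under it. -/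
theorem exists_common_action {Γ G H : Type*} [Group Γ] [Group G] [Group H] (hG : IsSofic G)
    (hH : IsSofic H) (hΓ : IsAmenable Γ) {α : Γ →* G} {β : Γ →* H} (hα : Function.Injective α)
    (hβ : Function.Injective β) (S : Finset G) (T : Finset H) (E : Finset Γ) {ε : ℝ}
    (hε : 0 < ε) :
    ∃ (Z : Type) (_ : Finite Z) (_ : Nonempty Z) (σ : G → Equiv.Perm Z) (ψ : H → Equiv.Perm Z)
      (tile : Z → Z),
      (∀ a ∈ S, ∀ b ∈ S, density {z | ¬ σ a (σ b z) = σ (a * b) z} ≤ ε) ∧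
      (∀ a ∈ T, ∀ b ∈ T, density {z | ¬ ψ a (ψ b z) = ψ (a * b) z} ≤ ε) ∧
      (∀ g ∈ S, g ≠ 1 → density {z | ¬ σ g z ≠ z} ≤ ε) ∧
      (∀ γ ∈ E, density {z | ¬ ψ (β γ) z = σ (α γ) z} ≤ ε) ∧
      (∀ γ ∈ E, density {z | ¬ tile (σ (α γ) z) = tile z} ≤ ε) ∧
      (∀ g ∈ S, g ∉ α.range → density {z | ¬ tile (σ g z) ≠ tile z} ≤ ε) ∧
      ∀ h ∈ T, h ∉ β.range → density {z | ¬ tile (ψ h z) ≠ tile z} ≤ ε := by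
  classical
  obtain ⟨A, hAne, hA⟩ := hΓ (E.image (·⁻¹)) (ε / 5) (by positivity)
  obtain ⟨C, hCfin, hC1, hCS, hCA, hCE⟩ := exists_finite_set α S A E
  obtain ⟨C', hCfin', hC1', hCT, hCA', hCE'⟩ := exists_finite_set β T A E
  have hCC : ∀ g ∈ C, g ∈ C * C := fun g hg => by simpa using Set.mul_mem_mul hg hC1
  have hCC' : ∀ g ∈ C', g ∈ C' * C' := fun g hg => by simpa using Set.mul_mem_mul hg hC1'
  have hδ : 0 < ε / 5 / (A.card + 1) := by positivity
  obtain ⟨n, σ, hn, hσ⟩ := exists_goodAt hG (hCfin.mul hCfin) hδ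
  obtain ⟨m, τ, hm, hτ⟩ := exists_goodAt hH (hCfin'.mul hCfin') hδ
  have : Nonempty (Fin n) := ⟨⟨0, hn⟩⟩
  have : Nonempty (Fin m) := ⟨⟨0, hm⟩⟩
  have : Nonempty (Fin n ⊕ Fin m ≃ Fin (n + m)) := ⟨finSumFinEquiv⟩
  obtain ⟨Θ, tile, D, hD, htG, htH, hΘ⟩ :=
    exists_matching hα hβ σ τ A C C' hC1 hC1' hCA hCA' (n + m)
  set Bx : Set (Fin n) := {x | ¬ GoodAt σ (C * C) x} ∪
    ⋃ a ∈ A, σ (α a⁻¹) ⁻¹' {x | ¬ GoodAt σ (C * C) x} with hBx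
  set K : Set (Fin n × Fin m × (Fin n ⊕ Fin m ≃ Fin (n + m))) := Prod.fst ⁻¹' Bx ∪
    Prod.snd ⁻¹' (Prod.fst ⁻¹' {y | ¬ GoodAt τ (C' * C') y}) with hK
  have hBxd : density Bx ≤ ε / 5 := by
    refine (density_union_le _ _).trans ((add_le_add hσ (density_biUnion_le A _ fun a _ =>
      (density_preimage_equiv (σ (α a⁻¹)) _).trans_le hσ)).trans_eq ?_)
    field_simp
    ring
  have hKd : density K ≤ 2 * (ε / 5) := by
    refine (density_union_le _ _).trans ?_
    rw [density_preimage_fst, density_preimage_snd, density_preimage_fst, two_mul]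
    refine add_le_add hBxd (hτ.trans (div_le_self (by positivity) ?_))
    exact le_add_of_nonneg_left (Nat.cast_nonneg _)
  have hgood : ∀ z ∉ K, GoodAt σ (C * C) z.1 ∧ (∀ a ∈ A, GoodAt σ (C * C) (σ (α a⁻¹) z.1)) ∧
      GoodAt τ (C' * C') z.2.1 := by
    intro z hz
    simp only [hK, hBx, Set.mem_union, Set.mem_preimage, Set.mem_ofPred_eq, Set.mem_iUnion,
      not_or, not_exists, not_not] at hz
    exact ⟨hz.1.1, hz.1.2, hz.2⟩
  have hKD : ∀ z ∉ K, z ∈ D := fun z hz =>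
    hD z.1 z.2.1 z.2.2 hAne (hgood z hz).1 (hgood z hz).2.1 (hgood z hz).2.2
  let σ' : G → Equiv.Perm (Fin n × Fin m × (Fin n ⊕ Fin m ≃ Fin (n + m))) := fun g =>
    Equiv.prodCongr (σ g) (Equiv.refl _)
  let τ' : H → Equiv.Perm (Fin n × Fin m × (Fin n ⊕ Fin m ≃ Fin (n + m))) := fun h =>
    Equiv.prodCongr (Equiv.refl _) (Equiv.prodCongr (τ h) (Equiv.refl _))
  let ψ : H → Equiv.Perm (Fin n × Fin m × (Fin n ⊕ Fin m ≃ Fin (n + m))) := fun h =>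
    (Θ.trans (τ' h)).trans Θ.symm
  have hψ : ∀ h z, Θ (ψ h z) = τ' h (Θ z) := fun h z => Θ.apply_symm_apply _
  have hM : ∀ γ ∈ E, density {z : Fin n × Fin m × (Fin n ⊕ Fin m ≃ Fin (n + m)) |
      ¬ ∃ b ∈ A, γ * b ∈ A ∧
      (∀ a ∈ A, z.2.2 (.inl (σ (α b⁻¹) z.1)) ≤ z.2.2 (.inl (σ (α a⁻¹) z.1))) ∧
      ∀ a ∈ A, z.2.2 (.inl (σ (α b⁻¹) z.1)) ≤ z.2.2 (.inl (σ (α (a⁻¹ * γ)) z.1))} ≤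
      3 * (ε / 5) := by
    intro γ hγ
    have hU₂ : (A.image (γ⁻¹ * ·)).image (·⁻¹) = A.image fun a => a⁻¹ * γ := by
      rw [Finset.image_image]
      exact Finset.image_congr fun a _ => by simp
    have hcard : (A.image (·⁻¹)).card = A.card :=
      Finset.card_image_of_injective _ inv_injective
    have hcard₂ : ((A.image (γ⁻¹ * ·)).image (·⁻¹)).card = A.card := by
      rw [Finset.card_image_of_injective _ inv_injective,
        Finset.card_image_of_injective _ (mul_right_injective _)]
    have hdiff : ((((A.image (γ⁻¹ * ·)).image (·⁻¹)) \ A.image (·⁻¹)).card : ℝ) ≤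
        ε / 5 * (A.image (·⁻¹)).card := by
      rw [← Finset.image_sdiff _ _ inv_injective, Finset.card_image_of_injective _ inv_injective,
        hcard]
      convert hA γ⁻¹ (Finset.mem_image_of_mem _ hγ)
    refine (density_le_of_fiber _ Bx (ε := 2 * (ε / 5)) (by positivity) fun x hx => ?_).trans
      (by linarith)
    have hx' : GoodAt σ (C * C) x := by
      by_contra h
      exact hx (.inl h)
    have hinj : Set.InjOn (fun u => (.inl (σ (α u) x) : Fin n ⊕ Fin m)) ↑(A.image (·⁻¹)) := by
      intro u hu v hv huv
      obtain ⟨a, ha, rfl⟩ := Finset.mem_image.1 (Finset.mem_coe.1 hu)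
      obtain ⟨b, hb, rfl⟩ := Finset.mem_image.1 (Finset.mem_coe.1 hv)
      exact hα (hx'.inj (hCC _ (hCA a ha).2) (hCC _ (hCA b hb).2) (Sum.inl_injective huv))
    have hfib := density_no_common_min_le (N := n + m) _ _ _ hinj (hAne.image _)
      (hcard.trans hcard₂.symm) hdiff
    rw [← density_preimage_snd (W := Fin m)] at hfib
    refine (density_mono fun v hv => ?_).trans hfib
    intro hv'
    refine hv ?_
    obtain ⟨u, hu, h1, h2⟩ := hv'
    rw [hU₂] at hu h2
    obtain ⟨hu1, hu2⟩ := Finset.mem_inter.1 hu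
    obtain ⟨b, hb, rfl⟩ := Finset.mem_image.1 hu1
    obtain ⟨a, ha, hab⟩ := Finset.mem_image.1 hu2
    refine ⟨b, hb, ?_, fun a ha => h1 _ (Finset.mem_image_of_mem _ ha),
      fun a ha => h2 _ (Finset.mem_image_of_mem _ ha)⟩
    have : γ * b = a := by
      rw [← inv_inv b, ← hab]
      group
    rwa [this]
  have hKε : density K ≤ ε := by linarith
  have hK2 : ∀ e : Equiv.Perm (Fin n × Fin m × (Fin n ⊕ Fin m ≃ Fin (n + m))),
      density (K ∪ e ⁻¹' K) ≤ ε := fun e => by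
    refine (density_union_le _ _).trans ?_
    rw [density_preimage_equiv]
    linarith
  have hag : ∀ γ ∈ E, density {z | ¬ (ψ (β γ) z = σ' (α γ) z ∧
      tile (σ' (α γ) z) = tile z)} ≤ ε := by
    intro γ hγ
    refine (density_mono (t := K ∪ _) fun z hz => ?_).trans ((density_union_le _ _).trans
      ((add_le_add hKd (hM γ hγ)).trans_eq (by ring)))
    by_contra h
    obtain ⟨h1, h2⟩ := not_or.1 h
    obtain ⟨g1, g2, g3⟩ := hgood z h1
    obtain ⟨e1, e2⟩ := hΘ z.1 z.2.1 z.2.2 γ (hCE γ hγ) (hCE' γ hγ) g1 g2 g3 (not_not.1 h2)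
    exact hz ⟨Θ.injective ((hψ _ _).trans e1.symm), e2⟩
  refine ⟨Fin n × Fin m × (Fin n ⊕ Fin m ≃ Fin (n + m)),
    inferInstance, inferInstance, σ', ψ, tile, ?_, ?_, ?_, ?_, ?_, ?_, ?_⟩
  · refine fun a ha b hb => (density_mono fun z hz => ?_).trans hKε
    by_contra h
    exact hz (Prod.ext ((hgood z h).1.mul a (hCC _ (hCS a ha)) b (hCC _ (hCS b hb))) rfl)
  · refine fun a ha b hb => (density_mono fun z hz => ?_).trans
      ((density_preimage_equiv Θ K).trans_le hKε)
    by_contra h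
    refine hz (Θ.injective ?_)
    rw [hψ, hψ, hψ]
    exact Prod.ext rfl (Prod.ext
      ((hgood _ h).2.2.mul a (hCC' _ (hCT a ha)) b (hCC' _ (hCT b hb))) rfl)
  · refine fun g hg hg1 => (density_mono fun z hz => ?_).trans hKε
    by_contra h
    refine hz fun hz' => hg1 ?_
    have hz1 := (hgood z h).1
    exact hz1.inj (hCC _ (hCS g hg)) (hCC _ hC1) ((congrArg Prod.fst hz').trans hz1.one.symm)
  · refine fun γ hγ => (density_mono fun z hz => ?_).trans (hag γ hγ)
    exact fun h => hz h.1
  · refine fun γ hγ => (density_mono fun z hz => ?_).trans (hag γ hγ)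
    exact fun h => hz h.2
  · refine fun g hg hgr => (density_mono fun z hz => ?_).trans (hK2 (σ' g))
    by_contra h
    obtain ⟨h1, h2⟩ := not_or.1 h
    exact hz fun ht => hgr (htG g (hCS g hg) z.1 z.2.1 z.2.2 (hKD _ h1) (hKD _ h2) ht)
  · refine fun g hg hgr => (density_mono fun z hz => ?_).trans (hK2 (ψ g))
    by_contra h
    obtain ⟨h1, h2⟩ := not_or.1 h
    exact hz fun ht => hgr (htH g (hCT g hg) z (ψ g z) (hKD _ h1) (hKD _ h2) (hψ g z) ht)

theorem eventually_almostAll_of_density_le {ι : Type*} {l : Filter ι} {W : ι → Type*}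
    [∀ i, Finite (W i)] {p : (Σ i, W i) → Prop} {ε : ι → ℝ} (hε : Tendsto ε l (𝓝 0))
    (h : ∀ᶠ i in l, density {w : W i | ¬ p ⟨i, w⟩} ≤ ε i) : ∀ᶠ q in almostAll l W, p q :=
  eventually_almostAll.2 (squeeze_zero' (Filter.Eventually.of_forall fun _ => density_nonneg _)
    h hε)

/-- An amalgamated product of two sofic groups over an amenable subgroup is sofic. -/
theorem isSofic_pushout {G H : Type} [Group G] [Group H] {Γ : Subgroup G} {φ : Γ →* H}
    (hG : IsSofic G) (hH : IsSofic H) (hΓ : IsAmenable Γ) (hφ : Function.Injective φ) :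
    IsSofic (Monoid.PushoutI (amalgHoms G H Γ φ)) := by
  classical
  let ε : Finset G × Finset H × Finset Γ × ℕ → ℝ := fun i => 1 / ((i.2.2.2 : ℝ) + 1)
  have hε : ∀ i, 0 < ε i := fun i => by positivity
  choose Z hZfin hZne σ ψ tile hσ hψ hfree hag htile htG htH using
    fun i : Finset G × Finset H × Finset Γ × ℕ =>
      exists_common_action hG hH hΓ Γ.subtype_injective hφ i.1 i.2.1 i.2.2.1 (hε i)
  have hlen : Tendsto (fun i : Finset G × Finset H × Finset Γ × ℕ => i.2.2.2) atTop atTop := by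
    simp only [← Filter.prod_atTop_atTop_eq]
    exact tendsto_snd.comp (tendsto_snd.comp tendsto_snd)
  have hε0 : Tendsto ε atTop (𝓝 0) := tendsto_one_div_add_atTop_nhds_zero_nat.comp hlen
  have hS : ∀ s : Finset G, ∀ᶠ i : Finset G × Finset H × Finset Γ × ℕ in atTop, s ⊆ i.1 := by
    intro s
    filter_upwards [eventually_ge_atTop (s, (∅ : Finset H), (∅ : Finset Γ), 0)] with i hi
    exact hi.1
  have hT : ∀ t : Finset H, ∀ᶠ i : Finset G × Finset H × Finset Γ × ℕ in atTop, t ⊆ i.2.1 := by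
    intro t
    filter_upwards [eventually_ge_atTop ((∅ : Finset G), t, (∅ : Finset Γ), 0)] with i hi
    exact hi.2.1
  have hE : ∀ γ : Γ, ∀ᶠ i : Finset G × Finset H × Finset Γ × ℕ in atTop, γ ∈ i.2.2.1 := by
    intro γ
    filter_upwards [eventually_ge_atTop ((∅ : Finset G), (∅ : Finset H), ({γ} : Finset Γ), 0)]
      with i hi
    exact hi.2.2.1 (Finset.mem_singleton_self γ)
  refine isSofic_pushout_of_matching hφ hlen (fun g i => σ i g) (fun h i => ψ i h) tile
    (fun a b => ?_) (fun a b => ?_) (fun g hg => ?_) (fun γ => ?_) (fun γ => ?_)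
    (fun g hg => ?_) fun h hh => ?_ <;> refine eventually_almostAll_of_density_le hε0 ?_
  · filter_upwards [hS {a, b}] with i hi
    exact hσ i a (hi (by simp)) b (hi (by simp))
  · filter_upwards [hT {a, b}] with i hi
    exact hψ i a (hi (by simp)) b (hi (by simp))
  · filter_upwards [hS {g}] with i hi
    exact hfree i g (hi (by simp)) hg
  · filter_upwards [hE γ] with i hi
    exact hag i γ hi
  · filter_upwards [hE γ] with i hi
    exact htile i γ hi
  · filter_upwards [hS {g}] with i hi
    exact htG i g (hi (by simp)) (by rwa [Subgroup.range_subtype])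
  · filter_upwards [hT {h}] with i hi
    exact htH i h (hi (by simp)) hh

end SoficAmalgam

/-- Let `G` and `H` be finitely generated sofic groups, `Γ ≤ G` a finitely
generated amenable subgroup and `φ : Γ → H` an injective homomorphism.  Then the amalgamated
free product `G *_φ H` is sofic. -/
theorem amalgamated_product_sofic_fg (G H : Type) [Group G] [Group H]
    (hGfg : Group.FG G) (hHfg : Group.FG H)
    (hGsofic : IsSofic G) (hHsofic : IsSofic H)
    (Γ : Subgroup G) (hΓfg : Group.FG ↥Γ) (hΓamen : IsAmenable ↥Γ)
    (φ : ↥Γ →* H) (hφ : Function.Injective φ) :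
    IsSofic (AmalgamatedProduct G H Γ φ) := by
  exact SoficAmalgam.isSofic_pushout hGsofic hHsofic hΓamen hφ
end

section
/- Free products of arbitrary (not necessarily finitely generated) sofic groups amalgamated over arbitrary amenable subgroups are sofic: if G, H are sofic groups, Γ ≤ G is amenable, and φ : Γ → H is injective, then G *_φ H is sofic. -/
open Filter Topology

/-- The proportion of the elements of a finite type that satisfy `P`. -/
noncomputable def dens {Z : Type*} (P : Z → Prop) : ℝ :=
  ({z | P z}.ncard : ℝ) / Nat.card Z

section Dens

variable {Z Z' : Type*}

lemma dens_nonneg (P : Z → Prop) : 0 ≤ dens P := by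
  unfold dens; positivity

lemma dens_mono [Finite Z] {P Q : Z → Prop} (h : ∀ z, P z → Q z) : dens P ≤ dens Q := by
  unfold dens
  gcongr
  · exact Set.toFinite _
  · exact h _

lemma dens_or_le (P Q : Z → Prop) : dens (fun z => P z ∨ Q z) ≤ dens P + dens Q := by
  unfold dens
  rw [← add_div]
  gcongr
  exact_mod_cast Set.ncard_union_le {z | P z} {z | Q z}

lemma dens_or_eq [Finite Z] {P Q : Z → Prop} (h : ∀ z, P z → ¬ Q z) :
    dens (fun z => P z ∨ Q z) = dens P + dens Q := by
  unfold dens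
  rw [← add_div]
  congr 1
  exact_mod_cast Set.ncard_union_eq (s := {z | P z}) (t := {z | Q z})
    (Set.disjoint_left.2 h)

lemma dens_false : dens (fun _ : Z => False) = 0 := by
  simp [dens]

lemma dens_true [Finite Z] [Nonempty Z] : dens (fun _ : Z => True) = 1 := by
  simp [dens, Set.ncard_univ]

lemma dens_le_one [Finite Z] [Nonempty Z] (P : Z → Prop) : dens P ≤ 1 :=
  (dens_mono fun _ _ => trivial).trans dens_true.le

lemma dens_not [Finite Z] [Nonempty Z] (P : Z → Prop) : dens (fun z => ¬ P z) = 1 - dens P := by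
  have h := dens_or_eq (P := P) (Q := fun z => ¬ P z) fun z hz => not_not.2 hz
  simp only [em, dens_true] at h
  linarith

lemma dens_exists_le [Finite Z] {ι : Type*} (A : Finset ι) (P : ι → Z → Prop) :
    dens (fun z => ∃ a ∈ A, P a z) ≤ ∑ a ∈ A, dens (P a) := by
  classical
  induction A using Finset.induction_on with
  | empty => simp [dens_false]
  | insert a A ha ih =>
    simp only [Finset.exists_mem_insert]
    rw [Finset.sum_insert ha]
    exact (dens_or_le _ _).trans (by gcongr)

lemma dens_exists_le_mul [Finite Z] {ι : Type*} (A : Finset ι) (P : ι → Z → Prop) {η : ℝ}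
    (h : ∀ a ∈ A, dens (P a) ≤ η) : dens (fun z => ∃ a ∈ A, P a z) ≤ A.card * η :=
  (dens_exists_le A P).trans (by simpa using Finset.sum_le_sum h)

lemma sum_dens_le_one [Finite Z] [Nonempty Z] {ι : Type*} (A : Finset ι) (P : ι → Z → Prop)
    (h : ∀ a ∈ A, ∀ b ∈ A, ∀ z, P a z → P b z → a = b) : ∑ a ∈ A, dens (P a) ≤ 1 := by
  classical
  suffices hs : ∑ a ∈ A, dens (P a) = dens (fun z => ∃ a ∈ A, P a z) from hs ▸ dens_le_one _
  induction A using Finset.induction_on with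
  | empty => simp [dens_false]
  | insert a A ha ih =>
    simp only [Finset.exists_mem_insert]
    rw [Finset.sum_insert ha, ih fun b hb c hc => h b (by simp [hb]) c (by simp [hc]), dens_or_eq]
    rintro z hz ⟨b, hb, hbz⟩
    exact ha (h a (by simp) b (by simp [hb]) z hz hbz ▸ hb)

lemma dens_equiv (e : Z ≃ Z') (P : Z' → Prop) : dens (fun z => P (e z)) = dens P := by
  unfold dens
  rw [Nat.card_congr e]
  congr 2
  rw [← Set.ncard_image_of_injective _ e.injective]
  congr 1
  ext z
  simp

lemma dens_fst [Finite Z'] [Nonempty Z'] (P : Z → Prop) :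
    dens (fun z : Z × Z' => P z.1) = dens P := by
  unfold dens
  have : {z : Z × Z' | P z.1} = {z | P z} ×ˢ Set.univ := by ext; simp
  rw [this, Set.ncard_prod, Nat.card_prod, Set.ncard_univ]
  have : (Nat.card Z' : ℝ) ≠ 0 := by exact_mod_cast Nat.card_pos.ne'
  push_cast
  field_simp

lemma dens_snd [Finite Z'] [Nonempty Z'] (P : Z → Prop) :
    dens (fun z : Z' × Z => P z.2) = dens P := by
  rw [← dens_fst (Z' := Z') P, ← dens_equiv (Equiv.prodComm Z' Z)]
  rfl

lemma dens_prod_le [Finite Z] [Nonempty Z] [Finite Z'] [Nonempty Z'] {P : Z × Z' → Prop}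
    {B : Z → Prop} {δ : ℝ}
    (h : ∀ z, ¬ B z → dens (fun w => P (z, w)) ≤ δ) (hδ : 0 ≤ δ) :
    dens P ≤ dens B + δ := by
  classical
  have := Fintype.ofFinite Z
  have hP : dens P ≤ dens (fun z : Z × Z' => B z.1) + dens (fun z : Z × Z' => ¬ B z.1 ∧ P z) :=
    (dens_mono fun z hz => by by_cases hB : B z.1 <;> simp [hB, hz]).trans (dens_or_le _ _)
  rw [dens_fst] at hP
  refine hP.trans (add_le_add_right ?_ _)
  have hcard : {z : Z × Z' | ¬ B z.1 ∧ P z}.ncard =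
      ∑ z : Z, {w : Z' | ¬ B z ∧ P (z, w)}.ncard := by
    rw [← Nat.card_coe_set_eq]
    exact (Nat.card_congr (Equiv.subtypeProdEquivSigmaSubtype fun z w => ¬ B z ∧ P (z, w))).trans
      Nat.card_sigma
  have hZ : (0 : ℝ) < Nat.card Z := by exact_mod_cast Nat.card_pos
  have hZ' : (0 : ℝ) < Nat.card Z' := by exact_mod_cast Nat.card_pos
  unfold dens
  rw [hcard, Nat.card_prod, Nat.cast_mul, div_le_iff₀ (mul_pos hZ hZ')]
  push_cast
  have key : ∀ z ∈ Finset.univ, ({w : Z' | ¬ B z ∧ P (z, w)}.ncard : ℝ) ≤ δ * Nat.card Z' := by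
    intro z _
    by_cases hB : B z
    · simpa [hB] using mul_nonneg hδ hZ'.le
    · have := h z hB
      unfold dens at this
      rw [div_le_iff₀ hZ'] at this
      simpa [hB] using this
  refine (Finset.sum_le_sum key).trans (le_of_eq ?_)
  simp
  ring

lemma rk_eq_dens {n : ℕ} (g : Equiv.Perm (Fin n)) :
    rk g = 1 - dens (fun x => g x = x) := by
  simp [rk, dens, Set.ncard_eq_toFinset_card']

lemma rk_eq_dens_ne {n : ℕ} (hn : 0 < n) (g : Equiv.Perm (Fin n)) :
    rk g = dens (fun x => g x ≠ x) := by
  have : Nonempty (Fin n) := ⟨⟨0, hn⟩⟩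
  rw [rk_eq_dens, ← dens_not]

end Dens

/-- In a uniformly random order, each element of `U` is the least one with probability at most
`1 / |U|`. -/
lemma dens_argmin_mul_card_le {n : ℕ} (U : Finset (Fin n)) {b : Fin n} (hb : b ∈ U) :
    dens (fun w : Equiv.Perm (Fin n) => ∀ u ∈ U, w b ≤ w u) * U.card ≤ 1 := by
  have hsum := sum_dens_le_one U (fun b (w : Equiv.Perm (Fin n)) => ∀ u ∈ U, w b ≤ w u)
    fun a ha c hc w h1 h2 => w.injective (le_antisymm (h1 c hc) (h2 a ha))
  have heq : ∀ a ∈ U, dens (fun w : Equiv.Perm (Fin n) => ∀ u ∈ U, w a ≤ w u) =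
      dens (fun w : Equiv.Perm (Fin n) => ∀ u ∈ U, w b ≤ w u) := by
    intro a ha
    rw [← dens_equiv (Equiv.mulRight (Equiv.swap a b))]
    congr 1
    funext w
    have hU : ∀ u ∈ U, Equiv.swap a b u ∈ U := by
      intro u hu
      rw [Equiv.swap_apply_def]
      split_ifs <;> assumption
    simp only [Equiv.coe_mulRight, Equiv.Perm.mul_apply, Equiv.swap_apply_left, eq_iff_iff]
    exact ⟨fun h u hu => by simpa using h _ (hU u hu), fun h u hu => h _ (hU u hu)⟩
  rw [Finset.sum_congr rfl heq] at hsum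
  simpa [mul_comm] using hsum

lemma dens_exists_argmin_le {n : ℕ} {U B : Finset (Fin n)} (hB : B ⊆ U) {m δ : ℝ} (hm : 0 < m)
    (hU : m ≤ U.card) (hBm : B.card ≤ δ * m) :
    dens (fun w : Equiv.Perm (Fin n) => ∃ b ∈ B, ∀ u ∈ U, w b ≤ w u) ≤ δ := by
  have h : ∀ b ∈ B, dens (fun w : Equiv.Perm (Fin n) => ∀ u ∈ U, w b ≤ w u) ≤ 1 / m := by
    intro b hb
    rw [le_div_iff₀ hm]
    exact (mul_le_mul_of_nonneg_left hU (dens_nonneg _)).trans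
      (dens_argmin_mul_card_le U (hB hb))
  refine (dens_exists_le_mul B _ h).trans ?_
  rw [mul_one_div, div_le_iff₀ hm]
  exact hBm

/-- `σ` is an almost action of `G`, almost free on the finite set `S`, with error `η`. -/
structure IsApproxFreeAction {G X : Type*} [Group G] (S : Finset G) (η : ℝ)
    (σ : G → Equiv.Perm X) : Prop where
  mul : ∀ g ∈ S, ∀ h ∈ S, dens (fun x => σ (g * h) x ≠ σ g (σ h x)) ≤ η
  fix : ∀ g ∈ S, g ≠ 1 → dens (fun x => σ g x = x) ≤ η
  sep : ∀ g ∈ S, ∀ h ∈ S, g ≠ h → dens (fun x => σ g x = σ h x) ≤ η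

lemma IsApproxFreeAction.mono {G X : Type*} [Group G] {S S' : Finset G} {η η' : ℝ}
    {σ : G → Equiv.Perm X} (h : IsApproxFreeAction S' η' σ) (hS : S ⊆ S') (hη : η' ≤ η) :
    IsApproxFreeAction S η σ where
  mul g hg k hk := (h.mul g (hS hg) k (hS hk)).trans hη
  fix g hg h1 := (h.fix g (hS hg) h1).trans hη
  sep g hg k hk hne := (h.sep g (hS hg) k (hS hk) hne).trans hη

lemma IsApproxFreeAction.prodCongr_refl {G X Y : Type*} [Group G] [Finite Y] [Nonempty Y]
    {S : Finset G} {η : ℝ} {σ : G → Equiv.Perm X} (h : IsApproxFreeAction S η σ) :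
    IsApproxFreeAction S η fun g => (σ g).prodCongr (Equiv.refl Y) where
  mul g hg k hk := by simpa [Prod.ext_iff] using (dens_fst _).trans_le (h.mul g hg k hk)
  fix g hg h1 := by simpa [Prod.ext_iff] using (dens_fst _).trans_le (h.fix g hg h1)
  sep g hg k hk hne := by simpa [Prod.ext_iff] using (dens_fst _).trans_le (h.sep g hg k hk hne)

lemma IsApproxFreeAction.permCongr {G X Y : Type*} [Group G] {S : Finset G} {η : ℝ}
    {σ : G → Equiv.Perm X} (h : IsApproxFreeAction S η σ) (e : X ≃ Y) :
    IsApproxFreeAction S η fun g => e.permCongr (σ g) where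
  mul g hg k hk := by
    rw [← dens_equiv e]
    simpa using h.mul g hg k hk
  fix g hg h1 := by
    rw [← dens_equiv e]
    simpa using h.fix g hg h1
  sep g hg k hk hne := by
    rw [← dens_equiv e]
    simpa using h.sep g hg k hk hne

lemma IsSofic.exists_isApproxFreeAction {G : Type*} [Group G] (hG : IsSofic G) (S : Finset G)
    {η : ℝ} (hη : 0 < η) :
    ∃ (n : ℕ) (σ : G → Equiv.Perm (Fin n)), 0 < n ∧ IsApproxFreeAction S η σ := by
  classical
  obtain ⟨n, σ, hn, hmul, hfree⟩ := hG
    (S ∪ (S ×ˢ S).image fun p => p.1 * p.2⁻¹) (η / 2) (half_pos hη)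
  have : Nonempty (Fin n) := ⟨⟨0, hn⟩⟩
  set S' := S ∪ (S ×ˢ S).image fun p => p.1 * p.2⁻¹ with hS'
  have hSS' : S ⊆ S' := Finset.subset_union_left
  have hdiv : ∀ g ∈ S, ∀ h ∈ S, g * h⁻¹ ∈ S' := fun g hg h hh =>
    Finset.mem_union_right _ (Finset.mem_image.2 ⟨(g, h), by simp [hg, hh], rfl⟩)
  have hmul' : ∀ g ∈ S', ∀ h ∈ S', dens (fun x => σ (g * h) x ≠ σ g (σ h x)) ≤ η / 2 := by
    intro g hg h hh
    refine le_trans (le_of_eq ?_) (hmul g hg h hh)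
    rw [rk_eq_dens_ne hn]
    congr 1
    funext x
    rw [Equiv.Perm.mul_apply, ne_eq, ne_eq, Equiv.Perm.inv_eq_iff_eq, Equiv.Perm.mul_apply]
  have hfix : ∀ g ∈ S', g ≠ 1 → dens (fun x => σ g x = x) ≤ η / 2 := by
    intro g hg h1
    have := hfree g hg h1
    rw [rk_eq_dens] at this
    linarith
  refine ⟨n, σ, hn, ?_, ?_, ?_⟩
  · exact fun g hg h hh => (hmul' g (hSS' hg) h (hSS' hh)).trans (by linarith)
  · exact fun g hg h1 => (hfix g (hSS' hg) h1).trans (by linarith)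
  · intro g hg h hh hne
    have h1 := hmul' _ (hdiv g hg h hh) h (hSS' hh)
    have h2 := hfix _ (hdiv g hg h hh) fun h1 => hne (by rwa [mul_inv_eq_one] at h1)
    rw [← dens_equiv (σ h)] at h2
    refine (dens_mono fun x hx => ?_).trans ((dens_or_le _ _).trans (add_le_add h1 h2)) |>.trans
      (by linarith)
    rw [inv_mul_cancel_right]
    by_contra! hcon
    exact hcon.2 (hcon.1.symm.trans hx)

/-- An amenable subgroup of a sofic group: there are sofic approximations of the group that admit
an almost equivariant map to the subgroup, with image in a finite set which is independent of the
quality of the approximation. -/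
theorem exists_almost_equivariant_map {G Γ : Type*} [Group G] [Group Γ] (hG : IsSofic G)
    (hΓ : IsAmenable Γ) {ι : Γ →* G}
    (hιinj : Function.Injective ι) (F : Finset Γ) {δ : ℝ} (hδ : 0 < δ) :
    ∃ A : Finset Γ, ∀ (S : Finset G) (η : ℝ), 0 < η →
      ∃ (X : Type) (_ : Finite X) (_ : Nonempty X) (σ : G → Equiv.Perm X) (c : X → Γ),
        IsApproxFreeAction S η σ ∧ (∀ x, c x ∈ A) ∧
        ∀ γ ∈ F, dens (fun x => c (σ (ι γ) x) ≠ γ * c x) ≤ δ := by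
  classical
  obtain ⟨A, hA, hFol⟩ := hΓ F (δ / 4) (by positivity)
  have hA0 : (0 : ℝ) < A.card := by exact_mod_cast hA.card_pos
  have hA1 : (1 : ℝ) ≤ A.card := by exact_mod_cast hA.card_pos
  refine ⟨A, fun S η hη => ?_⟩
  set η' := min η (δ / (6 * A.card ^ 2)) with hη'
  have hη'0 : 0 < η' := by positivity
  have hη'δ : 3 * (A.card : ℝ) ^ 2 * η' ≤ δ / 2 := by
    have : η' ≤ δ / (6 * A.card ^ 2) := min_le_right _ _
    rw [le_div_iff₀ (by positivity)] at this
    linarith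
  obtain ⟨n, σ, hn, hσ⟩ := hG.exists_isApproxFreeAction (S ∪ (A ∪ F).image ι) hη'0
  have : Nonempty (Fin n) := ⟨⟨0, hn⟩⟩
  have hι : ∀ a ∈ A ∪ F, ι a ∈ S ∪ (A ∪ F).image ι := fun a ha =>
    Finset.mem_union_right _ (Finset.mem_image_of_mem _ ha)
  have hmin : ∀ (x : Fin n) (w : Equiv.Perm (Fin n)), ∃ a ∈ A, ∀ b ∈ A,
      w ((σ (ι a)).symm x) ≤ w ((σ (ι b)).symm x) := fun x w =>
    Finset.exists_min_image A (fun a => w ((σ (ι a)).symm x)) hA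
  choose c hcA hc using hmin
  refine ⟨Fin n × Equiv.Perm (Fin n), inferInstance, inferInstance, _, fun p => c p.1 p.2,
    (hσ.mono Finset.subset_union_left (min_le_left _ _)).prodCongr_refl, fun p => hcA _ _, ?_⟩
  intro γ hγ
  set Bm : Fin n → Prop := fun x => ∃ a ∈ A, σ (ι γ * ι a) ((σ (ι a)).symm x) ≠
    σ (ι γ) (σ (ι a) ((σ (ι a)).symm x)) with hBm
  set Bi : Fin n → Prop := fun x => ∃ q ∈ A.offDiag,
    (σ (ι q.1)).symm x = (σ (ι q.2)).symm x with hBi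
  have hBm_le : dens Bm ≤ A.card * η' := by
    refine dens_exists_le_mul _ _ fun a ha => ?_
    rw [dens_equiv (σ (ι a)).symm (fun x => σ (ι γ * ι a) x ≠ σ (ι γ) (σ (ι a) x))]
    exact hσ.mul _ (hι γ (by simp [hγ])) _ (hι a (by simp [ha]))
  have hBi_le : dens Bi ≤ A.card ^ 2 * η' := by
    refine (dens_exists_le_mul (η := η') _ _ fun q hq => ?_).trans ?_
    · rw [Finset.mem_offDiag] at hq
      rw [← dens_equiv (σ (ι q.1))]
      simp only [Equiv.symm_apply_apply, Equiv.eq_symm_apply]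
      refine hσ.sep _ (hι q.2 (by simp [hq])) _ (hι q.1 (by simp [hq])) fun h => hq.2.2 ?_
      exact (hιinj h).symm
    · gcongr
      rw [Finset.offDiag_card, sq]
      exact_mod_cast Nat.sub_le _ _
  have hbad : dens (fun x => Bm x ∨ Bi x ∨ Bi (σ (ι γ) x)) ≤ δ / 2 := by
    have h1 := dens_or_le Bm (fun x => Bi x ∨ Bi (σ (ι γ) x))
    have h2 := dens_or_le Bi (fun x => Bi (σ (ι γ) x))
    rw [dens_equiv (σ (ι γ)) Bi] at h2
    have h3 : (A.card : ℝ) * η' ≤ A.card ^ 2 * η' := by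
      gcongr
      nlinarith
    linarith
  refine (dens_prod_le (B := fun x => Bm x ∨ Bi x ∨ Bi (σ (ι γ) x)) (δ := δ / 2) ?_
    (by positivity)).trans (by linarith)
  intro x hx
  simp only [not_or] at hx
  obtain ⟨hx1, hx2, hx3⟩ := hx
  have hinj : ∀ x, ¬ Bi x → Set.InjOn (fun a => (σ (ι a)).symm x) A := by
    intro x hx a ha b hb hab
    by_contra hne
    exact hx ⟨(a, b), by simpa using ⟨ha, hb, hne⟩, hab⟩
  set y := σ (ι γ) x with hy
  have hxy : ∀ a ∈ A, (σ (ι (γ * a))).symm y = (σ (ι a)).symm x := by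
    intro a ha
    by_contra hcon
    refine hx1 ⟨a, ha, fun h => hcon ?_⟩
    rw [Equiv.symm_apply_eq, map_mul, h, Equiv.apply_symm_apply]
  set U := A.image (fun a => (σ (ι a)).symm x) ∪ A.image (fun a => (σ (ι a)).symm y) with hU
  set B := (A.filter fun a => γ * a ∉ A).image (fun a => (σ (ι a)).symm x) ∪
    (A \ A.image (γ * ·)).image (fun a => (σ (ι a)).symm y) with hB
  have hUx : ∀ a ∈ A, (σ (ι a)).symm x ∈ U := fun a ha =>
    Finset.mem_union_left _ (Finset.mem_image.2 ⟨a, ha, rfl⟩)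
  have hUy : ∀ a ∈ A, (σ (ι a)).symm y ∈ U := fun a ha =>
    Finset.mem_union_right _ (Finset.mem_image.2 ⟨a, ha, rfl⟩)
  have hBU : B ⊆ U := Finset.union_subset_union
    (Finset.image_subset_image (Finset.filter_subset _ _))
    (Finset.image_subset_image Finset.sdiff_subset)
  have hUB : ∀ u ∈ U, u ∉ B → ∃ a ∈ A, γ * a ∈ A ∧ u = (σ (ι a)).symm x := by
    intro u hu hub
    simp only [hB, hU, Finset.mem_union, Finset.mem_image, Finset.mem_filter, Finset.mem_sdiff]
      at hu hub
    rcases hu with ⟨a, ha, rfl⟩ | ⟨a, ha, rfl⟩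
    · by_contra! hcon
      exact hub (Or.inl ⟨a, ⟨ha, fun h => hcon a ha h rfl⟩, rfl⟩)
    · by_contra! hcon
      refine hub (Or.inr ⟨a, ⟨ha, ?_⟩, rfl⟩)
      rintro ⟨b, hb, rfl⟩
      exact hcon b hb ha (hxy b hb)
  have hBcard : (B.card : ℝ) ≤ δ / 2 * A.card := by
    have hcard : (A.image (γ * ·)).card = A.card :=
      Finset.card_image_of_injective _ (mul_right_injective γ)
    have h1 : (A.filter fun a => γ * a ∉ A).card = (A.image (γ * ·) \ A).card := by
      rw [← Finset.card_image_of_injective _ (mul_right_injective γ)]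
      congr 1
      ext
      simp only [Finset.mem_image, Finset.mem_filter, Finset.mem_sdiff]
      constructor
      · rintro ⟨a, ⟨ha, hγa⟩, rfl⟩
        exact ⟨⟨a, ha, rfl⟩, hγa⟩
      · rintro ⟨⟨a, ha, rfl⟩, hγa⟩
        exact ⟨a, ⟨ha, hγa⟩, rfl⟩
    have h2 : (A \ A.image (γ * ·)).card = (A.image (γ * ·) \ A).card :=
      Finset.card_sdiff_comm hcard.symm
    have h3 : B.card ≤ (A.image (γ * ·) \ A).card + (A.image (γ * ·) \ A).card :=
      (Finset.card_union_le _ _).trans (add_le_add (Finset.card_image_le.trans h1.le)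
        (Finset.card_image_le.trans h2.le))
    have h4 : (B.card : ℝ) ≤ (A.image (γ * ·) \ A).card + (A.image (γ * ·) \ A).card := by
      exact_mod_cast h3
    linarith [hFol γ hγ]
  refine le_trans (dens_mono fun w hw => ?_)
    (dens_exists_argmin_le hBU hA0 ?_ hBcard)
  · by_contra hcon
    obtain ⟨u, hu, hmin⟩ := Finset.exists_min_image U w ⟨_, hUx _ hA.choose_spec⟩
    obtain ⟨a, ha, hγa, rfl⟩ := hUB u hu fun hB => hcon ⟨u, hB, hmin⟩
    have e1 : c x w = a := hinj x hx2 (hcA x w) ha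
      (w.injective (le_antisymm (hc x w a ha) (hmin _ (hUx _ (hcA x w)))))
    rw [← hxy a ha] at hmin
    have e2 : c y w = γ * a := hinj y hx3 (hcA y w) hγa
      (w.injective (le_antisymm (hc y w _ hγa) (hmin _ (hUy _ (hcA y w)))))
    exact hw (e2.trans (by rw [← e1]))
  · rw [← Finset.card_image_of_injOn (hinj x hx2)]
    exact_mod_cast Finset.card_le_card Finset.subset_union_left

/-- The permutations `g × 1` of `X × Y`, conjugated by `(x, y) ↦ (x, e x y)`. -/
def shearAct {G X Y : Type*} (σ : G → Equiv.Perm X) (e : X → Equiv.Perm Y) (g : G) :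
    Equiv.Perm (X × Y) :=
  (Equiv.prodShear (Equiv.refl X) e).permCongr ((σ g).prodCongr (Equiv.refl Y))

lemma shearAct_apply_shear {G X Y : Type*} (σ : G → Equiv.Perm X) (e : X → Equiv.Perm Y) (g : G)
    (x : X) (y : Y) : shearAct σ e g (x, e x y) = (σ g x, e (σ g x) y) := by
  simp [shearAct, Equiv.prodShear]

lemma dens_shear {X Y : Type*} (e : X → Equiv.Perm Y) (P : X × Y → Prop) :
    dens P = dens (fun z : X × Y => P (z.1, e z.1 z.2)) :=
  (dens_equiv (Equiv.prodShear (Equiv.refl X) e) P).symm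

lemma IsApproxFreeAction.dens_exists_mul_ne {G X : Type*} [Group G] [Finite X] {S : Finset G}
    {η : ℝ} {σ : G → Equiv.Perm X} (h : IsApproxFreeAction S η σ) {g : G} (hg : g ∈ S)
    {A : Finset G} (hA : A ⊆ S) :
    dens (fun x => ∃ a ∈ A, σ (g * a) x ≠ σ g (σ a x)) ≤ A.card * η :=
  dens_exists_le_mul _ _ fun a ha => h.mul g hg a (hA ha)

lemma IsApproxFreeAction.dens_exists_symm_mul_ne {G X : Type*} [Group G] [Finite X]
    {S : Finset G} {η : ℝ} {σ : G → Equiv.Perm X} (h : IsApproxFreeAction S η σ) {g : G}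
    (hg : g ∈ S) {A : Finset G} (hA : A ⊆ S) :
    dens (fun x => ∃ a ∈ A, (σ (g * a)).symm (σ g x) ≠ (σ a).symm x) ≤ A.card * η := by
  refine dens_exists_le_mul _ _ fun a ha => ?_
  rw [← dens_equiv (σ a)]
  refine (dens_mono fun x hx heq => hx ?_).trans (h.mul g hg a (hA ha))
  rw [← heq, Equiv.symm_apply_apply, Equiv.symm_apply_apply]

/-- For most points, the `A`-tiles of `x` and `g x` are different, if `g ∉ A A⁻¹`. -/
lemma IsApproxFreeAction.dens_exists_symm_eq {G X : Type*} [Group G] [Finite X] {S : Finset G}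
    {η : ℝ} {σ : G → Equiv.Perm X} (h : IsApproxFreeAction S η σ) {g : G} (hg : g ∈ S)
    {A : Finset G} (hA : A ⊆ S) (hgA : ∀ a ∈ A, g * a ∈ S ∧ g * a ∉ A) :
    dens (fun x => ∃ q ∈ A ×ˢ A, (σ q.2).symm (σ g x) = (σ q.1).symm x) ≤
      A.card ^ 2 * (2 * η) := by
  refine (dens_exists_le_mul (η := 2 * η) _ _ fun q hq => ?_).trans (by simp [sq])
  obtain ⟨h1, h2⟩ := Finset.mem_product.1 hq
  rw [← dens_equiv (σ q.1)]
  have hm := h.mul g hg q.1 (hA h1)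
  have hs := h.sep (g * q.1) (hgA _ h1).1 q.2 (hA h2) fun hcon => (hgA _ h1).2 (hcon ▸ h2)
  refine ((dens_mono fun x hx => ?_).trans (dens_or_le _ _)).trans
    ((add_le_add hm hs).trans (by linarith))
  rw [Equiv.symm_apply_apply, Equiv.symm_apply_eq] at hx
  by_contra! hcon
  exact hcon.2 (hcon.1.trans hx)

/-- Shearing by an almost equivariant map turns `g × 1` into a map close to the diagonal map. -/
lemma dens_shearAct_ne_le {G H X Y : Type*} [Group H] [Finite X] [Nonempty X]
    [Finite Y] [Nonempty Y] {S : Finset H} {η δ : ℝ} {σ : G → Equiv.Perm X}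
    {ρ : H → Equiv.Perm Y} (hρ : IsApproxFreeAction S η ρ) {A : Finset H} (hA : A ⊆ S)
    {c : X → H} (hc : ∀ x, c x ∈ A) {g : G} {h : H} (hh : h ∈ S)
    (heq : dens (fun x => c (σ g x) ≠ h * c x) ≤ δ) :
    dens (fun z : X × Y => shearAct σ (fun x => ρ (c x)) g z ≠ (σ g z.1, ρ h z.2)) ≤
      δ + A.card * η := by
  rw [dens_shear fun x => ρ (c x)]
  simp only [shearAct_apply_shear]
  have h1 := hρ.dens_exists_mul_ne hh hA
  rw [← dens_fst (Z' := Y)] at heq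
  rw [← dens_snd (Z' := X)] at h1
  refine ((dens_mono fun z hz => ?_).trans (dens_or_le _ _)).trans (add_le_add heq h1)
  by_contra! hcon
  refine hz ?_
  rw [hcon.1, hcon.2 _ (hc _)]

lemma mul_notMem_image_of_notMem_range {Γ K : Type*} [Group Γ] [Group K] [DecidableEq K]
    {f : Γ →* K} {g : K} (hg : g ∉ f.range) {A : Finset Γ} {a : K} (ha : a ∈ A.image f) :
    g * a ∉ A.image f := by
  obtain ⟨x, -, rfl⟩ := Finset.mem_image.1 ha
  intro h
  obtain ⟨y, -, hy⟩ := Finset.mem_image.1 h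
  exact hg ⟨y * x⁻¹, by rw [map_mul, hy, map_inv, mul_inv_cancel_right]⟩

/-- Almost free almost actions of two sofic groups on the same finite set that almost agree on a
common amenable subgroup `Γ`, with a labelling of the points which is almost invariant under `Γ`,
but is changed almost everywhere by each element outside of `Γ`. -/
theorem exists_compatible_approxFreeActions {G H Γ : Type*} [Group G] [Group H] [Group Γ]
    (hG : IsSofic G) (hH : IsSofic H) (hΓ : IsAmenable Γ) {ι : Γ →* G} {φ : Γ →* H}
    (hι : Function.Injective ι) (hφ : Function.Injective φ) (S : Finset G) (R : Finset H)
    {ε : ℝ} (hε : 0 < ε) :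
    ∃ (Z : Type) (_ : Finite Z) (_ : Nonempty Z) (α : G → Equiv.Perm Z) (β : H → Equiv.Perm Z)
      (t : Z → Z), IsApproxFreeAction S ε α ∧ IsApproxFreeAction R ε β ∧
      (∀ γ, ι γ ∈ S → φ γ ∈ R → dens (fun z => α (ι γ) z ≠ β (φ γ) z) ≤ ε) ∧
      (∀ γ, ι γ ∈ S → dens (fun z => t (α (ι γ) z) ≠ t z) ≤ ε) ∧
      (∀ g ∈ S, g ∉ ι.range → dens (fun z => t (α g z) = t z) ≤ ε) ∧
      (∀ h ∈ R, h ∉ φ.range → dens (fun z => t (β h z) = t z) ≤ ε) := by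
  classical
  obtain ⟨A, hA⟩ := exists_almost_equivariant_map hG hΓ hι (S.preimage ι hι.injOn)
    (δ := ε / 4) (by positivity)
  obtain ⟨B, hB⟩ := exists_almost_equivariant_map hH hΓ hφ (R.preimage φ hφ.injOn)
    (δ := ε / 4) (by positivity)
  set N : ℝ := A.card + B.card + 1 with hN
  have hN1 : 1 ≤ N := by
    have : (0 : ℝ) ≤ A.card + B.card := by positivity
    linarith
  set η := ε / (4 * N ^ 2) with hη
  have hη0 : 0 < η := by positivity
  have hηε : N ^ 2 * η = ε / 4 := by
    rw [hη]
    field_simp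
  have hNη : N * η ≤ ε / 4 := by
    rw [← hηε]
    gcongr
    nlinarith
  have hη_le : η ≤ ε := by nlinarith
  have hAN : (A.card : ℝ) ≤ N := by
    have : (0 : ℝ) ≤ B.card := by positivity
    linarith
  have hBN : (B.card : ℝ) ≤ N := by
    have : (0 : ℝ) ≤ A.card := by positivity
    linarith
  set S' := S ∪ (A ∪ B).image ι ∪ (S ×ˢ A).image fun p => p.1 * ι p.2 with hS'
  set R' := R ∪ (A ∪ B).image φ ∪ (R ×ˢ A).image fun p => p.1 * φ p.2 with hR'
  obtain ⟨X, _, _, σ, c, hσ, hcA, hc⟩ := hA S' η hη0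
  obtain ⟨Y, _, _, ρ, d, hρ, hdB, hd⟩ := hB R' η hη0
  have hSS' : S ⊆ S' := Finset.subset_union_left.trans Finset.subset_union_left
  have hRR' : R ⊆ R' := Finset.subset_union_left.trans Finset.subset_union_left
  have hAS : A.image ι ⊆ S' := (Finset.image_subset_image Finset.subset_union_left).trans
    (Finset.subset_union_right.trans Finset.subset_union_left)
  have hBS : B.image ι ⊆ S' := (Finset.image_subset_image Finset.subset_union_right).trans
    (Finset.subset_union_right.trans Finset.subset_union_left)
  have hAR : A.image φ ⊆ R' := (Finset.image_subset_image Finset.subset_union_left).trans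
    (Finset.subset_union_right.trans Finset.subset_union_left)
  have hcι : ∀ x, ι (c x) ∈ A.image ι := fun x => Finset.mem_image_of_mem _ (hcA x)
  have hcφ : ∀ x, φ (c x) ∈ A.image φ := fun x => Finset.mem_image_of_mem _ (hcA x)
  have hdι : ∀ y, ι (d y) ∈ B.image ι := fun y => Finset.mem_image_of_mem _ (hdB y)
  have hAι : (A.image ι).card = A.card := Finset.card_image_of_injective _ hι
  have hAφ : (A.image φ).card = A.card := Finset.card_image_of_injective _ hφ
  have hBι : (B.image ι).card = B.card := Finset.card_image_of_injective _ hι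
  have hA2 : (A.card : ℝ) ^ 2 * (2 * η) ≤ ε := by
    have : (A.card : ℝ) ^ 2 * η ≤ N ^ 2 * η := by gcongr
    linarith
  have hAη : (A.card : ℝ) * η ≤ ε / 4 := le_trans (by gcongr) hNη
  have hBη : (B.card : ℝ) * η ≤ ε / 4 := le_trans (by gcongr) hNη
  have hcm : ∀ γ, ι γ ∈ S → dens (fun x => c (σ (ι γ) x) ≠ γ * c x) ≤ ε / 4 := fun γ hγ =>
    hc γ (Finset.mem_preimage.2 hγ)
  have hdm : ∀ γ, φ γ ∈ R → dens (fun y => d (ρ (φ γ) y) ≠ γ * d y) ≤ ε / 4 := fun γ hγ =>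
    hd γ (Finset.mem_preimage.2 hγ)
  have hcφm : ∀ γ, ι γ ∈ S →
      dens (fun x => φ (c (σ (ι γ) x)) ≠ φ γ * φ (c x)) ≤ ε / 4 := fun γ hγ => by
    simpa only [← map_mul, hφ.ne_iff] using hcm γ hγ
  have hdιm : ∀ γ, φ γ ∈ R →
      dens (fun y => ι (d (ρ (φ γ) y)) ≠ ι γ * ι (d y)) ≤ ε / 4 := fun γ hγ => by
    simpa only [← map_mul, hι.ne_iff] using hdm γ hγ
  refine ⟨X × Y, inferInstance, inferInstance, shearAct σ fun x => ρ (φ (c x)),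
    fun h => (Equiv.prodComm Y X).permCongr (shearAct ρ (fun y => σ (ι (d y))) h),
    fun z => ((σ (ι (c z.1))).symm z.1, (ρ (φ (c z.1))).symm z.2),
    (hσ.mono hSS' hη_le).prodCongr_refl.permCongr _,
    ((hρ.mono hRR' hη_le).prodCongr_refl.permCongr _).permCongr _, ?_, ?_, ?_, ?_⟩
  · intro γ hγS hγR
    have h1 := dens_shearAct_ne_le hρ hAR hcφ (hRR' hγR) (hcφm γ hγS)
    have h2 := dens_shearAct_ne_le hσ hBS hdι (hSS' hγS) (hdιm γ hγR)
    rw [hAφ] at h1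
    rw [hBι, ← dens_equiv (Equiv.prodComm X Y)] at h2
    refine ((dens_mono fun z hz => ?_).trans (dens_or_le _ _)).trans
      ((add_le_add h1 h2).trans (by linarith))
    by_contra! hcon
    refine hz (hcon.1.trans ?_)
    have := hcon.2
    rw [Equiv.prodComm_apply] at this
    simp [Equiv.permCongr_apply, this]
  · intro γ hγ
    rw [dens_shear fun x => ρ (φ (c x))]
    simp only [shearAct_apply_shear, Equiv.symm_apply_apply]
    have h1 := hcm γ hγ
    have h2 := hσ.dens_exists_symm_mul_ne (hSS' hγ) hAS
    rw [hAι] at h2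
    rw [← dens_fst (Z' := Y)] at h1 h2
    refine ((dens_mono fun z hz => ?_).trans (dens_or_le _ _)).trans
      ((add_le_add h1 h2).trans (by linarith))
    by_contra! hcon
    refine hz (Prod.ext ?_ rfl)
    rw [hcon.1, map_mul]
    exact hcon.2 _ (hcι _)
  · intro g hg hgr
    rw [dens_shear fun x => ρ (φ (c x))]
    simp only [shearAct_apply_shear, Equiv.symm_apply_apply]
    have h1 := hσ.dens_exists_symm_eq (hSS' hg) hAS fun a ha =>
      ⟨?_, mul_notMem_image_of_notMem_range hgr ha⟩
    · rw [hAι, ← dens_fst (Z' := Y)] at h1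
      refine (dens_mono fun z hz => ?_).trans (h1.trans hA2)
      exact ⟨(ι (c z.1), ι (c (σ g z.1))), Finset.mem_product.2 ⟨hcι _, hcι _⟩,
        congrArg Prod.fst hz⟩
    · obtain ⟨b, hb, rfl⟩ := Finset.mem_image.1 ha
      exact Finset.mem_union_right _ (Finset.mem_image.2 ⟨(g, b), by simp [hg, hb], rfl⟩)
  · intro h hh hhr
    rw [← dens_equiv (Equiv.prodComm Y X), dens_shear fun y => σ (ι (d y))]
    simp only [Equiv.permCongr_apply, Equiv.prodComm_apply, Prod.swap_prod_mk]
    have h1 := hρ.dens_exists_symm_eq (hRR' hh) hAR fun a ha =>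
      ⟨?_, mul_notMem_image_of_notMem_range hhr ha⟩
    · rw [hAφ, ← dens_fst (Z' := X)] at h1
      refine (dens_mono fun z hz => ?_).trans (h1.trans hA2)
      exact ⟨(φ (c _), φ (c _)), Finset.mem_product.2 ⟨hcφ _, hcφ _⟩, congrArg Prod.snd hz⟩
    · obtain ⟨b, hb, rfl⟩ := Finset.mem_image.1 ha
      exact Finset.mem_union_right _ (Finset.mem_image.2 ⟨(h, b), by simp [hh, hb], rfl⟩)

/-- A finite group generated by involutions without short relations. -/
lemma exists_finite_group_map_chain_prod_ne_one (T : Type) [Finite T] (L : ℕ) :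
    ∃ (K : Type) (_ : Group K) (_ : Finite K) (s : T → K), (∀ t, s t * s t = 1) ∧
      ∀ l : List T, l ≠ [] → l.IsChain (· ≠ ·) → l.length ≤ L → (l.map s).prod ≠ 1 := by
  classical
  let V := {l : List T // l.IsChain (· ≠ ·) ∧ l.length ≤ L}
  have : Finite V :=
    ((List.finite_length_le T L).subset fun l (hl : l.IsChain (· ≠ ·) ∧ l.length ≤ L) => hl.2)
  let f : T → List T → List T := fun t l =>
    if l.head? = some t then l.tail else if l.length < L then t :: l else l
  have hfV : ∀ t (l : V), (f t l).IsChain (· ≠ ·) ∧ (f t l).length ≤ L := by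
    rintro t ⟨l, hl, hlen⟩
    simp only [f]
    split_ifs with h1 h2
    · exact ⟨hl.tail, by simp; omega⟩
    · exact ⟨List.isChain_cons.2 ⟨fun y hy h => h1 (h ▸ hy), hl⟩, by simp; omega⟩
    · exact ⟨hl, hlen⟩
  have hff : ∀ t (l : V), f t (f t l) = l := by
    rintro t ⟨l, hl, hlen⟩
    cases l with
    | nil =>
      by_cases hL : 0 < L <;> simp [f, hL]
    | cons a l =>
      obtain ⟨hal, -⟩ := List.isChain_cons.1 hl
      simp only [List.length_cons] at hlen
      by_cases hat : a = t
      · subst hat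
        have : l.head? ≠ some a := fun h => hal a h rfl
        simp [f, this, show l.length < L by omega]
      · by_cases hL : l.length + 1 < L <;> simp [f, hL, hat]
  let s : T → Equiv.Perm V := fun t =>
    Function.Involutive.toPerm (fun l => ⟨f t l, hfV t l⟩) fun l => Subtype.ext (hff t l)
  refine ⟨Equiv.Perm V, inferInstance, inferInstance, s,
    fun t => Equiv.ext fun l => Subtype.ext (hff t l), ?_⟩
  have key : ∀ l : List T, l.IsChain (· ≠ ·) → l.length ≤ L →
      ((l.map s).prod ⟨[], by simp⟩).1 = l := by
    intro l
    induction l with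
    | nil => simp
    | cons a l ih =>
      intro hl hlen
      obtain ⟨hal, hl'⟩ := List.isChain_cons.1 hl
      simp only [List.length_cons] at hlen
      have h1 := ih hl' (by omega)
      have : l.head? ≠ some a := fun h => hal a h rfl
      rw [List.map_cons, List.prod_cons, Equiv.Perm.mul_apply]
      change f a ((l.map s).prod ⟨[], by simp⟩).1 = a :: l
      rw [h1]
      simp [f, this, show l.length < L by omega]
  intro l hne hl hlen h1
  have := key l hl hlen
  rw [h1] at this
  exact hne this.symm

section Words

variable {G H : Type} {Z T K : Type}

/-- The permutation by which a letter acts. -/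
def letterAct (α : G → Equiv.Perm Z) (β : H → Equiv.Perm Z) : (Σ b, fam G H b) → Equiv.Perm Z
  | ⟨true, g⟩ => α g
  | ⟨false, h⟩ => β h

/-- The trajectory of `z` under the word `l` has two consecutive points with the same label. -/
def LabelCollision {U : Type*} (act : U → Equiv.Perm Z) (t : Z → T) : List U → Z → Prop
  | [], _ => False
  | u :: l, z => LabelCollision act t l z ∨
      t (act u ((l.map act).prod z)) = t ((l.map act).prod z)

lemma dens_labelCollision_le [Finite Z] {U : Type*} (act : U → Equiv.Perm Z) (t : Z → T) {ε : ℝ}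
    (l : List U) (h : ∀ u ∈ l, dens (fun z => t (act u z) = t z) ≤ ε) :
    dens (LabelCollision act t l) ≤ l.length * ε := by
  induction l with
  | nil =>
    rw [show LabelCollision act t [] = fun _ => False from rfl, dens_false]
    simp
  | cons u l ih =>
    have h1 := h u (by simp)
    rw [← dens_equiv (l.map act).prod] at h1
    refine (dens_or_le _ _).trans ((add_le_add (ih fun v hv => h v (by simp [hv])) h1).trans ?_)
    simp only [List.length_cons]
    push_cast
    linarith

/-- The action of the letters of `G` on `Z × K` that is trivial on `K`. -/
def trivialLift (K : Type) (α : G → Equiv.Perm Z) (g : G) : Equiv.Perm (Z × K) :=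
  (α g).prodCongr (Equiv.refl K)

/-- The lift of `β` to `Z × K` by the coboundary of `s ∘ t`. -/
def coboundaryLift [Group K] (β : H → Equiv.Perm Z) (t : Z → T) (s : T → K) :
    H → Equiv.Perm (Z × K) :=
  shearAct β fun z => Equiv.mulLeft (s (t z))

lemma coboundaryLift_apply [Group K] (β : H → Equiv.Perm Z) (t : Z → T) (s : T → K) (h : H)
    (z : Z) (k : K) :
    coboundaryLift β t s h (z, k) = (β h z, s (t (β h z)) * ((s (t z))⁻¹ * k)) := by
  simpa [coboundaryLift] using
    shearAct_apply_shear β (fun z => Equiv.mulLeft (s (t z))) h z ((s (t z))⁻¹ * k)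

/-- Along a trajectory without label collisions, the `K`-coordinate is multiplied by a word in
the labels without repetitions. -/
lemma exists_chain_of_not_labelCollision [Group K] (α : G → Equiv.Perm Z) (β : H → Equiv.Perm Z)
    (t : Z → T) (s : T → K) (hs : ∀ t, s t * s t = 1) (l : List (Σ b, fam G H b))
    (hl : l.IsChain fun u v => u.1 ≠ v.1) (z : Z) (hz : ¬ LabelCollision (letterAct α β) t l z) :
    ∃ ts : List T, ts.IsChain (· ≠ ·) ∧ ts.length ≤ 2 * l.length ∧
      (∀ k, (l.map (letterAct (trivialLift K α) (coboundaryLift β t s))).prod (z, k) =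
        ((l.map (letterAct α β)).prod z, (ts.map s).prod * k)) ∧
      ((∃ u ∈ l, u.1 = false) → ts ≠ []) ∧
      ((∀ u ∈ l.head?, u.1 ≠ false) →
        ∀ τ ∈ ts.head?, τ ≠ t ((l.map (letterAct α β)).prod z)) ∧
      ((∀ u ∈ l.head?, u.1 ≠ true) →
        ∀ τ ∈ ts.head?, τ = t ((l.map (letterAct α β)).prod z)) := by
  induction l with
  | nil => exact ⟨[], by simp⟩
  | cons u l ih =>
    obtain ⟨hul, hl'⟩ := List.isChain_cons.1 hl
    rw [LabelCollision, not_or] at hz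
    obtain ⟨ts, hts, hlen, hprod, hne, h1, h2⟩ := ih hl' hz.1
    set y := (l.map (letterAct α β)).prod z with hy
    obtain ⟨b, g⟩ := u
    cases b with
    | true =>
      refine ⟨ts, hts, by simp; omega, fun k => ?_, ?_, fun _ τ hτ => ?_, fun h => ?_⟩
      · simp only [List.map_cons, List.prod_cons, Equiv.Perm.mul_apply, hprod]
        rfl
      · rintro ⟨u, hu, hu1⟩
        rcases List.mem_cons.1 hu with rfl | hu
        · simp at hu1
        · exact hne ⟨u, hu, hu1⟩
      · rw [h2 (fun v hv => (hul v hv).symm) τ hτ]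
        exact fun h => hz.2 h.symm
      · exact absurd rfl (h ⟨true, g⟩ rfl)
    | false =>
      refine ⟨t (β g y) :: t y :: ts, ?_, by simp; omega, fun k => ?_, by simp, fun h => ?_,
        fun _ τ hτ => ?_⟩
      · refine List.isChain_cons.2 ⟨?_, List.isChain_cons.2 ⟨?_, hts⟩⟩
        · rintro _ ⟨⟩
          exact hz.2
        · exact fun τ hτ => (h1 (fun v hv => (hul v hv).symm) τ hτ).symm
      · simp only [List.map_cons, List.prod_cons, Equiv.Perm.mul_apply, hprod]
        refine (coboundaryLift_apply β t s g y _).trans ?_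
        rw [inv_eq_of_mul_eq_one_left (hs _), mul_assoc, mul_assoc]
        rfl
      · exact absurd rfl (h ⟨false, g⟩ rfl)
      · simp only [List.head?_cons, Option.mem_def, Option.some.injEq] at hτ
        rw [← hτ]
        rfl

end Words

/-- Approximations of two sofic groups that are simultaneously almost free along words of bounded
length which are alternating modulo the common amenable subgroup. -/
theorem exists_approx_free_on_words {G H : Type} {Γ : Type*} [Group G] [Group H] [Group Γ]
    (hG : IsSofic G) (hH : IsSofic H) (hΓ : IsAmenable Γ) {ι : Γ →* G} {φ : Γ →* H}
    (hι : Function.Injective ι) (hφ : Function.Injective φ) (S : Finset G) (R : Finset H)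
    (L : ℕ) {ε : ℝ} (hε : 0 < ε) :
    ∃ (Z : Type) (_ : Finite Z) (_ : Nonempty Z) (α : G → Equiv.Perm Z) (β : H → Equiv.Perm Z),
      IsApproxFreeAction S ε α ∧ IsApproxFreeAction R ε β ∧
      (∀ γ, ι γ ∈ S → φ γ ∈ R → dens (fun z => α (ι γ) z ≠ β (φ γ) z) ≤ ε) ∧
      ∀ (g : G) (l : List (Σ b, fam G H b)), (l.IsChain fun u v => u.1 ≠ v.1) →
        l.length ≤ L → (∀ g, ⟨true, g⟩ ∈ l → g ∈ S ∧ g ∉ ι.range) →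
        (∀ h, ⟨false, h⟩ ∈ l → h ∈ R ∧ h ∉ φ.range) → (∃ u ∈ l, u.1 = false) →
        dens (fun z => α g ((l.map (letterAct α β)).prod z) = z) ≤ ε := by
  set ε' := ε / (L + 2) with hε'
  have hε'0 : 0 < ε' := by positivity
  have hεL : (L + 2) * ε' = ε := by
    rw [hε']
    field_simp
  have hL : 0 ≤ L * ε' := by positivity
  obtain ⟨Z, _, _, α, β, t, hα, hβ, hαβ, htγ, htG, htH⟩ :=
    exists_compatible_approxFreeActions hG hH hΓ hι hφ S R hε'0
  obtain ⟨K, _, _, s, hs, hK⟩ := exists_finite_group_map_chain_prod_ne_one Z (2 * L)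
  refine ⟨Z × K, inferInstance, inferInstance, trivialLift K α, coboundaryLift β t s,
    (hα.mono subset_rfl (by linarith)).prodCongr_refl,
    (hβ.mono subset_rfl (by linarith)).prodCongr_refl.permCongr _, ?_, ?_⟩
  · intro γ hγS hγR
    have h1 := hαβ γ hγS hγR
    have h2 := htγ γ hγS
    rw [← dens_fst (Z' := K)] at h1 h2
    refine ((dens_mono fun z hz => ?_).trans (dens_or_le _ _)).trans
      ((add_le_add h1 h2).trans (by linarith))
    by_contra! hcon
    refine hz ?_
    rw [coboundaryLift_apply, ← hcon.1, hcon.2, mul_inv_cancel_left]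
    rfl
  · intro g l hl hlen hlS hlR hex
    have h1 : dens (LabelCollision (letterAct α β) t l) ≤ l.length * ε' := by
      refine dens_labelCollision_le _ _ _ fun u hu => ?_
      obtain ⟨b, u⟩ := u
      cases b with
      | true => exact htG u (hlS u hu).1 (hlS u hu).2
      | false => exact htH u (hlR u hu).1 (hlR u hu).2
    rw [← dens_fst (Z' := K)] at h1
    have h2 : (l.length : ℝ) * ε' ≤ L * ε' := by gcongr
    refine (dens_mono ?_).trans (h1.trans (by linarith))
    rintro ⟨z, k⟩ hz
    by_contra hcon
    obtain ⟨ts, hts, htslen, hprod, hne, -, -⟩ :=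
      exists_chain_of_not_labelCollision α β t s hs l hl z hcon
    rw [hprod] at hz
    exact hK ts (hne hex) hts (by omega) (mul_eq_right.1 (congrArg Prod.snd hz))

section MetricProduct

variable {I : Type*}

/-- The families of permutations that move a proportion of points tending to zero. -/
def asymptoticallyTrivial (Z : I → Type*) [∀ i, Finite (Z i)] (l : Filter I) :
    Subgroup (∀ i, Equiv.Perm (Z i)) where
  carrier := {p | Tendsto (fun i => dens fun z => p i z ≠ z) l (𝓝 0)}
  one_mem' := by simpa [dens_false] using tendsto_const_nhds
  mul_mem' {p q} hp hq := by
    refine squeeze_zero (fun i => dens_nonneg _) (fun i => ?_) (by simpa using hp.add hq)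
    refine (dens_mono fun z hz => ?_).trans (dens_or_le _ _)
    by_contra! hcon
    rw [Pi.mul_apply, Equiv.Perm.mul_apply, hcon.2, hcon.1] at hz
    exact hz rfl
  inv_mem' {p} hp := by
    refine hp.congr fun i => ?_
    congr 1
    funext z
    rw [Pi.inv_apply, ne_eq, ne_eq, Equiv.Perm.inv_eq_iff_eq]
    exact propext (not_congr eq_comm)

variable {Z : I → Type*} [∀ i, Finite (Z i)]

instance (l : Filter I) : (asymptoticallyTrivial Z l).Normal where
  conj_mem p hp q := by
    refine Tendsto.congr (fun i => ?_) hp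
    rw [← dens_equiv (q i)⁻¹]
    congr 1
    funext z
    simp [Equiv.eq_symm_apply]

lemma mk_asymptoticallyTrivial_eq_iff {l : Filter I} {p q : ∀ i, Equiv.Perm (Z i)} :
    (p : (∀ i, Equiv.Perm (Z i)) ⧸ asymptoticallyTrivial Z l) = q ↔
      Tendsto (fun i => dens fun z => p i z ≠ q i z) l (𝓝 0) := by
  rw [QuotientGroup.eq]
  refine tendsto_congr fun i => ?_
  congr 1
  funext z
  rw [Pi.mul_apply, Pi.inv_apply, Equiv.Perm.mul_apply, ne_eq, ne_eq, Equiv.Perm.inv_eq_iff_eq]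
  exact propext (not_congr eq_comm)

/-- A group is sofic if it maps to a metric reduced product of finite symmetric groups in such a
way that each nontrivial element is represented by asymptotically fixed-point-free
permutations. -/
lemma isSofic_of_hom [∀ i, Nonempty (Z i)] {l : Filter I} [l.NeBot] {P : Type*} [Group P]
    (Ψ : P →* (∀ i, Equiv.Perm (Z i)) ⧸ asymptoticallyTrivial Z l)
    (hΨ : ∀ p ≠ 1, ∃ x : ∀ i, Equiv.Perm (Z i), (x : _ ⧸ asymptoticallyTrivial Z l) = Ψ p ∧
      Tendsto (fun i => dens fun z => x i z = z) l (𝓝 0)) : IsSofic P := by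
  intro F ε hε
  have hmul : ∀ p q, ∀ᶠ i in l,
      dens (fun z => ((Ψ p).out i * (Ψ q).out i) z ≠ (Ψ (p * q)).out i z) < ε := by
    intro p q
    have : (((Ψ p).out * (Ψ q).out : ∀ i, Equiv.Perm (Z i)) : _ ⧸ asymptoticallyTrivial Z l) =
        ((Ψ (p * q)).out : ∀ i, Equiv.Perm (Z i)) := by
      rw [QuotientGroup.mk_mul, QuotientGroup.out_eq', QuotientGroup.out_eq',
        QuotientGroup.out_eq', map_mul]
    exact (mk_asymptoticallyTrivial_eq_iff.1 this).eventually_lt_const hε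
  have hfree : ∀ p, ∀ᶠ i in l, p ≠ 1 → dens (fun z => (Ψ p).out i z = z) < ε := by
    intro p
    by_cases hp : p = 1
    · simp [hp]
    obtain ⟨x, hx, hx0⟩ := hΨ p hp
    rw [← QuotientGroup.out_eq' (Ψ p), mk_asymptoticallyTrivial_eq_iff] at hx
    have h0 := hx.add hx0
    rw [add_zero] at h0
    filter_upwards [h0.eventually_lt_const hε] with i hi _
    refine ((dens_mono fun z hz => ?_).trans (dens_or_le _ _)).trans_lt hi
    by_contra! hcon
    exact hcon.2 (hcon.1.trans hz)
  have hall := ((F.eventually_all (l := l)).2 fun p _ =>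
    (F.eventually_all (l := l)).2 fun q _ => hmul p q).and
      ((F.eventually_all (l := l)).2 fun p _ => hfree p)
  obtain ⟨i, hi1, hi2⟩ := hall.exists
  let e := Finite.equivFin (Z i)
  have hn : 0 < Nat.card (Z i) := Nat.card_pos
  refine ⟨Nat.card (Z i), fun p => e.permCongr ((Ψ p).out i), hn, ?_, ?_⟩
  · intro p hp q hq
    refine le_trans (le_of_eq ?_) (hi1 p hp q hq).le
    rw [rk_eq_dens_ne hn, ← dens_equiv e]
    congr 1
    funext z
    rw [Equiv.Perm.mul_apply, ne_eq, ne_eq, Equiv.Perm.inv_eq_iff_eq]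
    simp [eq_comm]
  · intro p hp hp1
    rw [rk_eq_dens, ← dens_equiv e]
    have := hi2 p hp hp1
    simp only [Equiv.permCongr_apply, Equiv.symm_apply_apply, EmbeddingLike.apply_eq_iff_eq]
    linarith

/-- A family of almost actions with errors tending to zero is a homomorphism to the metric
reduced product. -/
def homOfTendsto {G : Type*} [Group G] (l : Filter I) (α : G → ∀ i, Equiv.Perm (Z i))
    (h : ∀ g k, Tendsto (fun i => dens fun z => α (g * k) i z ≠ α g i (α k i z)) l (𝓝 0)) :
    G →* (∀ i, Equiv.Perm (Z i)) ⧸ asymptoticallyTrivial Z l :=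
  MonoidHom.mk' (fun g => (α g : _ ⧸ asymptoticallyTrivial Z l)) fun g k =>
    mk_asymptoticallyTrivial_eq_iff.2 (h g k)

end MetricProduct

/-- An element of an amalgamated product outside the image of the first factor is the product of
an element of the base group and a word in which a letter of the second factor occurs, whose
letters are outside of the base group and alternate between the factors. -/
lemma exists_word_of_notMem_range {G H : Type} [Group G] [Group H] {Γ : Subgroup G} {φ : ↥Γ →* H}
    (hφ : Function.Injective φ) (p : Monoid.PushoutI (amalgHoms G H Γ φ))
    (hp : p ∉ (Monoid.PushoutI.of (φ := amalgHoms G H Γ φ) true).range) :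
    ∃ (γ : Γ) (l : List (Σ b, fam G H b)),
      p = Monoid.PushoutI.base (amalgHoms G H Γ φ) γ *
        (l.map fun u => Monoid.PushoutI.of (φ := amalgHoms G H Γ φ) u.1 u.2).prod ∧
      (l.IsChain fun u v => u.1 ≠ v.1) ∧ (∀ u ∈ l, u.2 ∉ (amalgHoms G H Γ φ u.1).range) ∧
      ∃ u ∈ l, u.1 = false := by
  classical
  have hinj : ∀ b, Function.Injective (amalgHoms G H Γ φ b)
    | true => Subtype.val_injective
    | false => hφ
  obtain ⟨d⟩ := Monoid.PushoutI.NormalWord.transversal_nonempty _ hinj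
  obtain ⟨w, rfl⟩ := (Monoid.PushoutI.NormalWord.equiv (d := d)).symm.surjective p
  change w.prod ∉ _ at hp
  change ∃ γ l, w.prod = _ ∧ _
  have hw : w.prod = Monoid.PushoutI.base (amalgHoms G H Γ φ) w.head *
      (w.toList.map fun u => Monoid.PushoutI.of (φ := amalgHoms G H Γ φ) u.1 u.2).prod := by
    rw [Monoid.PushoutI.NormalWord.prod, Monoid.CoprodI.Word.prod, map_list_prod, List.map_map]
    congr 3
  refine ⟨w.head, w.toList, hw, w.chain_ne, ?_, ?_⟩
  · rintro ⟨b, g⟩ hu hg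
    have := (d.compl b).1 (a₁ := (⟨g, hg⟩, ⟨1, d.one_mem b⟩))
      (a₂ := (⟨1, one_mem _⟩, ⟨g, w.normalized b g hu⟩)) (by simp)
    simp only [Prod.mk.injEq, Subtype.mk.injEq] at this
    exact w.ne_one _ hu this.1
  · by_contra! hcon
    refine hp ?_
    rw [hw]
    refine mul_mem ?_ (Subgroup.list_prod_mem _ fun x hx => ?_)
    · exact ⟨amalgHoms G H Γ φ true w.head, Monoid.PushoutI.of_apply_eq_base _ _ _⟩
    · obtain ⟨⟨b, g⟩, hu, rfl⟩ := List.mem_map.1 hx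
      cases b with
      | true => exact ⟨g, rfl⟩
      | false => exact absurd rfl (hcon _ hu)

/-- Free products of arbitrary sofic groups amalgamated over arbitrary
amenable subgroups are sofic: if `G`, `H` are sofic, `Γ ≤ G` is amenable and `φ : Γ → H` is
an injective homomorphism, then `G *_φ H` is sofic. -/
theorem amalgamated_product_sofic (G H : Type) [Group G] [Group H]
    (hGsofic : IsSofic G) (hHsofic : IsSofic H)
    (Γ : Subgroup G) (hΓamen : IsAmenable ↥Γ)
    (φ : ↥Γ →* H) (hφ : Function.Injective φ) :
    IsSofic (AmalgamatedProduct G H Γ φ) := by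

  classical
  choose Z hfin hne α β hα hβ hαβ hword using fun i : Finset G × Finset H × ℕ =>
    exists_approx_free_on_words hGsofic hHsofic hΓamen (ι := Γ.subtype) Subtype.val_injective hφ
      i.1 i.2.1 i.2.2 (Nat.one_div_pos_of_nat (α := ℝ) (n := i.2.2))
  let l : Filter (Finset G × Finset H × ℕ) := atTop
  have hS : ∀ S, ∀ᶠ i in l, S ⊆ i.1 := fun S =>
    (eventually_ge_atTop (S, ∅, 0)).mono fun i hi => hi.1
  have hR : ∀ R, ∀ᶠ i in l, R ⊆ i.2.1 := fun R =>
    (eventually_ge_atTop (∅, R, 0)).mono fun i hi => hi.2.1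
  have hk : ∀ k, ∀ᶠ i in l, k ≤ i.2.2 := fun k =>
    (eventually_ge_atTop (∅, ∅, k)).mono fun i hi => hi.2.2
  have hlim : Tendsto (fun i : Finset G × Finset H × ℕ => 1 / ((i.2.2 : ℝ) + 1)) l (𝓝 0) :=
    tendsto_one_div_add_atTop_nhds_zero_nat.comp (tendsto_atTop.2 hk)
  have hzero : ∀ P : ∀ i, Z i → Prop, (∀ᶠ i in l, dens (P i) ≤ 1 / ((i.2.2 : ℝ) + 1)) →
      Tendsto (fun i => dens (P i)) l (𝓝 0) := fun P hP =>
    squeeze_zero' (.of_forall fun i => dens_nonneg _) hP hlim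
  let a : G →* (∀ i, Equiv.Perm (Z i)) ⧸ asymptoticallyTrivial Z l :=
    homOfTendsto l (fun g i => α i g) fun g k => hzero _ <| (hS {g, k}).mono fun i hi =>
      (hα i).mul g (hi (by simp)) k (hi (by simp))
  let b : H →* (∀ i, Equiv.Perm (Z i)) ⧸ asymptoticallyTrivial Z l :=
    homOfTendsto l (fun h i => β i h) fun g k => hzero _ <| (hR {g, k}).mono fun i hi =>
      (hβ i).mul g (hi (by simp)) k (hi (by simp))
  have hab : ∀ γ, b (φ γ) = a γ := fun γ => Eq.symm <|
    mk_asymptoticallyTrivial_eq_iff.2 <| hzero _ <|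
      ((hS {(γ : G)}).and (hR {φ γ})).mono fun i hi =>
        hαβ i γ (hi.1 (by simp)) (hi.2 (by simp))
  let f : ∀ c, fam G H c →* (∀ i, Equiv.Perm (Z i)) ⧸ asymptoticallyTrivial Z l
    | true => a
    | false => b
  let Ψ : Monoid.PushoutI (amalgHoms G H Γ φ) →*
      (∀ i, Equiv.Perm (Z i)) ⧸ asymptoticallyTrivial Z l :=
    Monoid.PushoutI.lift f (a.comp Γ.subtype) fun
      | true => rfl
      | false => MonoidHom.ext hab
  have hf : ∀ u : Σ c, fam G H c,
      f u.1 u.2 = ((fun i => letterAct (α i) (β i) u : ∀ i, Equiv.Perm (Z i)) :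
        _ ⧸ asymptoticallyTrivial Z l)
    | ⟨true, _⟩ => rfl
    | ⟨false, _⟩ => rfl
  refine isSofic_of_hom (P := Monoid.PushoutI (amalgHoms G H Γ φ)) Ψ fun p hp => ?_
  by_cases hrange : p ∈ (Monoid.PushoutI.of (φ := amalgHoms G H Γ φ) true).range
  · obtain ⟨g, rfl⟩ := hrange
    refine ⟨fun i => α i g, (Monoid.PushoutI.lift_of f _ _ (i := true) g).symm, hzero _ ?_⟩
    filter_upwards [hS {g}] with i hi
    exact (hα i).fix g (hi (Finset.mem_singleton_self g)) fun h => hp (by rw [h]; exact map_one _)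
  · obtain ⟨γ, w, rfl, hchain, hw, hex⟩ := exists_word_of_notMem_range hφ p hrange
    refine ⟨fun i => α i γ * (w.map (letterAct (α i) (β i))).prod, ?_, hzero _ ?_⟩
    · rw [map_mul, Monoid.PushoutI.lift_base, map_list_prod, List.map_map]
      have hΨ : (Ψ ∘ fun u => Monoid.PushoutI.of (φ := amalgHoms G H Γ φ) u.1 u.2) =
          QuotientGroup.mk' (asymptoticallyTrivial Z l) ∘
            fun u i => letterAct (α i) (β i) u := by
        funext u
        exact (Monoid.PushoutI.lift_of f _ _ u.2).trans (hf u)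
      have hprod : (fun i => (w.map (letterAct (α i) (β i))).prod) =
          (w.map fun u i => letterAct (α i) (β i) u).prod := by
        funext i
        rw [Pi.list_prod_apply]
        simp [Function.comp_def]
      rw [hΨ, ← List.map_map, ← map_list_prod, ← hprod]
      rfl
    · let S : List G := w.filterMap fun
        | ⟨true, g⟩ => some g
        | ⟨false, _⟩ => none
      let R : List H := w.filterMap fun
        | ⟨true, _⟩ => none
        | ⟨false, h⟩ => some h
      filter_upwards [hS S.toFinset, hR R.toFinset, hk w.length] with i hiS hiR hik
      refine hword i γ w hchain hik (fun g hg => ⟨hiS ?_, hw _ hg⟩)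
        (fun h hh => ⟨hiR ?_, hw _ hh⟩) hex
      · exact List.mem_toFinset.2 (List.mem_filterMap.2 ⟨_, hg, rfl⟩)
      · exact List.mem_toFinset.2 (List.mem_filterMap.2 ⟨_, hh, rfl⟩)
end
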